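/- arXiv:math/0612680 — 4 statements merged into one kernel-verified Lean document; each statement's English description precedes it below -/
import Mathlib

section
/- Let E be a complex inner product space and let A, B : E → E be linear maps which are symmetric, i.e. (x, Ay) = (Ax, y) and (x, By) = (Bx, y) for all x, y ∈ E. Assume (φ, Aφ) ≥ ‖Bφ‖² for all φ ∈ E, and assume there are ε ∈ [0,1) and c > 0 such that |2 Re(B²φ, Aφ) − 2 (Bφ, A Bφ)| ≤ ε ‖B²φ‖² + c ‖φ‖² for all φ ∈ E (the quantity inside the absolute value is the value (φ,[B,[B,A]]φ) of the double-commutator form, and it is real). Then ‖Aφ‖² ≥ (1 − ε) ‖B²φ‖² − c ‖φ‖² for all φ ∈ E. -/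
open scoped InnerProductSpace ComplexOrder

/-- **Double commutator improvement lemma.**
Let `E` be a complex inner product space and `A B : E → E` symmetric linear maps with
`(φ, Aφ) ≥ ‖Bφ‖²` and `|(φ,[B,[B,A]]φ)| = |2 Re(B²φ, Aφ) − 2 (Bφ, A Bφ)| ≤ ε‖B²φ‖² + c‖φ‖²`
for some `ε ∈ [0,1)` and `c > 0`.  Then `‖Aφ‖² ≥ (1−ε)‖B²φ‖² − c‖φ‖²` for all `φ ∈ E`. -/
theorem double_commutator_estimate
    {E : Type*} [NormedAddCommGroup E] [InnerProductSpace ℂ E]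
    (A B : E →ₗ[ℂ] E)
    (hAsymm : ∀ x y : E, ⟪x, A y⟫_ℂ = ⟪A x, y⟫_ℂ)
    (hBsymm : ∀ x y : E, ⟪x, B y⟫_ℂ = ⟪B x, y⟫_ℂ)
    (hAB : ∀ φ : E, ‖B φ‖ ^ 2 ≤ (⟪φ, A φ⟫_ℂ).re)
    (ε c : ℝ) (hε0 : 0 ≤ ε) (hε1 : ε < 1) (hc : 0 < c)
    (hcomm : ∀ φ : E,
      |2 * (⟪B (B φ), A φ⟫_ℂ).re - 2 * (⟪B φ, A (B φ)⟫_ℂ).re| ≤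
        ε * ‖B (B φ)‖ ^ 2 + c * ‖φ‖ ^ 2) :
    ∀ φ : E, (1 - ε) * ‖B (B φ)‖ ^ 2 - c * ‖φ‖ ^ 2 ≤ ‖A φ‖ ^ 2 := by
  intro φ
  have h_form := hAB (B φ)
  have h_comm := (abs_le.mp (hcomm φ)).1
  have h_cauchy : (⟪B (B φ), A φ⟫_ℂ).re ≤ ‖B (B φ)‖ * ‖A φ‖ :=
    re_inner_le_norm (𝕜 := ℂ) (B (B φ)) (A φ)
  linarith [two_mul_le_add_sq ‖B (B φ)‖ ‖A φ‖]
end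

section
/- Let X be a C_b^∞-vector field on ℝ^d and let exp(tX)(x) denote its flow. Then for every multi-index α (in the space variable x) and every integer k ≥ 0 with |α| + k ≥ 1 there exist M, ω > 0 such that |∂_t^k ∂_x^α exp(tX)(x)| ≤ M e^{ω|t|} uniformly for all t ∈ ℝ and x ∈ ℝ^d. -/
open MeasureTheory Complex Real Finset

noncomputable section

/-- Euclidean space `ℝ^d`. -/
abbrev Ec (d : ℕ) := EuclideanSpace ℝ (Fin d)

variable {d : ℕ}

/-- The `L²` norm of a complex-valued function. -/
def l2norm (f : Ec d → ℂ) : ℝ := (∫ x, ‖f x‖ ^ 2).sqrt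

/-- Smooth compactly supported test functions. -/
def IsCc (φ : Ec d → ℂ) : Prop := ContDiff ℝ (⊤ : ℕ∞) φ ∧ HasCompactSupport φ

/-- A `C_b^∞`-vector field on `ℝ^d`: a smooth coefficient map `a : ℝ^d → ℝ^d` which is
bounded together with all its derivatives. -/
def IsCbVF (a : Ec d → Ec d) : Prop :=
  ContDiff ℝ (⊤ : ℕ∞) a ∧ ∀ n : ℕ, ∃ C : ℝ, ∀ x, ‖iteratedFDeriv ℝ n a x‖ ≤ C

/-- `f` is the (smooth, globally defined) flow `f t x = exp(tX)(x)` of the vector field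
with coefficient map `a`:  `f 0 x = x` and `∂_t f t x = a (f t x)`. -/
def IsFlowOf (a : Ec d → Ec d) (f : ℝ → Ec d → Ec d) : Prop :=
  ContDiff ℝ (⊤ : ℕ∞) (fun p : ℝ × Ec d => f p.1 p.2) ∧
    (∀ x, f 0 x = x) ∧
    ∀ t x, HasDerivAt (fun s => f s x) (a (f t x)) t

/-- The iterated partial derivative, in the space variable, of an `ℝ^d`-valued map along a
list of coordinate directions. -/
def pdVList (l : List (Fin d)) (g : Ec d → Ec d) : Ec d → Ec d :=
  l.foldr (fun j h => fun x => fderiv ℝ h x (EuclideanSpace.single j 1)) g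

/-- The canonical list of directions associated with a multi-index `α : Fin d → ℕ`. -/
def idxList {d : ℕ} (α : Fin d → ℕ) : List (Fin d) :=
  (List.finRange d).flatMap fun k => List.replicate (α k) k

/-- The spatial partial derivative `∂_x^α` of an `ℝ^d`-valued map. -/
def pdVMulti (α : Fin d → ℕ) (g : Ec d → Ec d) : Ec d → Ec d := pdVList (idxList α) g

/-- `g` is smooth on `ℝ × E`, and its derivatives up to order `n` grow at most exponentially in
the time variable, uniformly in the space variable. -/
def HasExpGrowth {E V : Type*} [NormedAddCommGroup E] [NormedSpace ℝ E]
    [NormedAddCommGroup V] [NormedSpace ℝ V] (n : ℕ) (g : ℝ × E → V) : Prop :=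
  ContDiff ℝ (⊤ : ℕ∞) g ∧ ∀ m ≤ n, ∃ M ω : ℝ, 0 ≤ M ∧ 0 ≤ ω ∧
    ∀ p : ℝ × E, ‖iteratedFDeriv ℝ m g p‖ ≤ M * Real.exp (ω * |p.1|)

/-- The restriction of a derivative on `ℝ × E` to the space directions. -/
def spatialPart (E V : Type*) [NormedAddCommGroup E] [NormedSpace ℝ E]
    [NormedAddCommGroup V] [NormedSpace ℝ V] : ((ℝ × E) →L[ℝ] V) →L[ℝ] (E →L[ℝ] V) :=
  (ContinuousLinearMap.compL ℝ E (ℝ × E) V).flip (ContinuousLinearMap.inr ℝ ℝ E)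

section

universe u

variable {E V W Z : Type u} [NormedAddCommGroup E] [NormedSpace ℝ E]
  [NormedAddCommGroup V] [NormedSpace ℝ V] [NormedAddCommGroup W] [NormedSpace ℝ W]
  [NormedAddCommGroup Z] [NormedSpace ℝ Z] {n : ℕ} {g h : ℝ × E → V}

lemma spatialPart_apply (T : (ℝ × E) →L[ℝ] V) (v : E) : spatialPart E V T v = T (0, v) := rfl

lemma contDiff_fderiv_top {F : Type*} [NormedAddCommGroup F] [NormedSpace ℝ F] {g : F → V}
    (hg : ContDiff ℝ (⊤ : ℕ∞) g) : ContDiff ℝ (⊤ : ℕ∞) (fderiv ℝ g) :=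
  hg.fderiv_right (by simp)

lemma differentiable_of_top {F : Type*} [NormedAddCommGroup F] [NormedSpace ℝ F] {g : F → V}
    (hg : ContDiff ℝ (⊤ : ℕ∞) g) : Differentiable ℝ g :=
  hg.differentiable (by simp)

lemma hasExpGrowth_zero_iff : HasExpGrowth 0 g ↔ ContDiff ℝ (⊤ : ℕ∞) g ∧
    ∃ M ω : ℝ, 0 ≤ M ∧ 0 ≤ ω ∧ ∀ p : ℝ × E, ‖g p‖ ≤ M * Real.exp (ω * |p.1|) := by
  simp [HasExpGrowth]

lemma HasExpGrowth.mono {m : ℕ} (hg : HasExpGrowth n g) (hmn : m ≤ n) : HasExpGrowth m g :=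
  ⟨hg.1, fun k hk => hg.2 k (hk.trans hmn)⟩

lemma hasExpGrowth_succ_iff :
    HasExpGrowth (n + 1) g ↔ HasExpGrowth 0 g ∧ HasExpGrowth n (fderiv ℝ g) := by
  constructor
  · intro hg
    refine ⟨hg.mono (Nat.zero_le _), contDiff_fderiv_top hg.1, fun m hm => ?_⟩
    simpa only [norm_iteratedFDeriv_fderiv] using hg.2 (m + 1) (by omega)
  · rintro ⟨h0, h1⟩
    refine ⟨h0.1, fun m hm => ?_⟩
    cases m with
    | zero => exact h0.2 0 le_rfl
    | succ m => simpa only [norm_iteratedFDeriv_fderiv] using h1.2 m (by omega)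

lemma HasExpGrowth.add (hg : HasExpGrowth n g) (hh : HasExpGrowth n h) :
    HasExpGrowth n (fun p => g p + h p) := by
  refine ⟨hg.1.add hh.1, fun m hm => ?_⟩
  obtain ⟨M, ω, hM, hω, H⟩ := hg.2 m hm
  obtain ⟨M', ω', hM', hω', H'⟩ := hh.2 m hm
  refine ⟨M + M', ω + ω', by positivity, by positivity, fun p => ?_⟩
  have hadd : iteratedFDeriv ℝ m (fun p => g p + h p) p
      = iteratedFDeriv ℝ m g p + iteratedFDeriv ℝ m h p :=
    iteratedFDeriv_add_apply (hg.1.of_le (by exact_mod_cast le_top)).contDiffAt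
      (hh.1.of_le (by exact_mod_cast le_top)).contDiffAt
  rw [hadd, add_mul]
  refine (norm_add_le _ _).trans (add_le_add ((H p).trans ?_) ((H' p).trans ?_)) <;>
  · gcongr
    linarith

lemma HasExpGrowth.clm_apply (L : V →L[ℝ] W) (hg : HasExpGrowth n g) :
    HasExpGrowth n (fun p => L (g p)) := by
  refine ⟨L.contDiff.comp hg.1, fun m hm => ?_⟩
  obtain ⟨M, ω, hM, hω, H⟩ := hg.2 m hm
  refine ⟨‖L‖ * M, ω, by positivity, hω, fun p => ?_⟩
  refine (L.norm_iteratedFDeriv_comp_left (hg.1.contDiffAt (x := p)) (n := m)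
    (by exact_mod_cast le_top)).trans ?_
  rw [mul_assoc]
  exact mul_le_mul_of_nonneg_left (H p) (norm_nonneg _)

lemma HasExpGrowth.bilinear_zero (B : V →L[ℝ] W →L[ℝ] Z) {k : ℝ × E → W}
    (hg : HasExpGrowth 0 g) (hk : HasExpGrowth 0 k) :
    HasExpGrowth 0 (fun p => B (g p) (k p)) := by
  refine hasExpGrowth_zero_iff.2 ⟨(B.contDiff.comp hg.1).clm_apply hk.1, ?_⟩
  obtain ⟨M, ω, hM, hω, H⟩ := (hasExpGrowth_zero_iff.1 hg).2
  obtain ⟨M', ω', hM', hω', H'⟩ := (hasExpGrowth_zero_iff.1 hk).2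
  refine ⟨‖B‖ * M * M', ω + ω', by positivity, by positivity, fun p => ?_⟩
  calc ‖B (g p) (k p)‖ ≤ ‖B‖ * ‖g p‖ * ‖k p‖ := B.le_opNorm₂ _ _
    _ ≤ ‖B‖ * (M * Real.exp (ω * |p.1|)) * (M' * Real.exp (ω' * |p.1|)) := by
      gcongr
      exacts [H p, H' p]
    _ = ‖B‖ * M * M' * Real.exp ((ω + ω') * |p.1|) := by
      rw [add_mul, Real.exp_add]; ring

lemma HasExpGrowth.bilinear (B : V →L[ℝ] W →L[ℝ] Z) {k : ℝ × E → W} (hg : HasExpGrowth n g)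
    (hk : HasExpGrowth n k) : HasExpGrowth n (fun p => B (g p) (k p)) := by
  induction n generalizing V W Z with
  | zero => exact hg.bilinear_zero B hk
  | succ n ih =>
    have hg' := hasExpGrowth_succ_iff.1 hg
    have hk' := hasExpGrowth_succ_iff.1 hk
    have hD : fderiv ℝ (fun p => B (g p) (k p)) = fun p =>
        B.precompR (ℝ × E) (g p) (fderiv ℝ k p) + B.precompL (ℝ × E) (fderiv ℝ g p) (k p) := by
      funext p
      exact B.fderiv_of_bilinear (differentiable_of_top hg.1 p) (differentiable_of_top hk.1 p)
    refine hasExpGrowth_succ_iff.2 ⟨hg'.1.bilinear_zero B hk'.1, ?_⟩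
    rw [hD]
    exact (ih _ (hg.mono n.le_succ) hk'.2).add (ih _ hg'.2 (hk.mono n.le_succ))

/-- A `C_b^∞` map composed with a smooth map whose derivative grows at most exponentially. -/
lemma HasExpGrowth.comp_of_bounded {b : V → W} (hb : ContDiff ℝ (⊤ : ℕ∞) b)
    (hbd : ∀ n : ℕ, ∃ C : ℝ, ∀ x, ‖iteratedFDeriv ℝ n b x‖ ≤ C) (hg : ContDiff ℝ (⊤ : ℕ∞) g)
    (hn : ∀ m < n, HasExpGrowth m (fderiv ℝ g)) : HasExpGrowth n (fun p => b (g p)) := by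
  have h0 : ∀ {W : Type u} [NormedAddCommGroup W] [NormedSpace ℝ W] {b : V → W},
      ContDiff ℝ (⊤ : ℕ∞) b → (∀ n : ℕ, ∃ C : ℝ, ∀ x, ‖iteratedFDeriv ℝ n b x‖ ≤ C) →
      HasExpGrowth 0 (fun p => b (g p)) := by
    intro W _ _ b hb hbd
    obtain ⟨C, hC⟩ := hbd 0
    refine hasExpGrowth_zero_iff.2 ⟨hb.comp hg, |C|, 0, abs_nonneg _, le_rfl, fun p => ?_⟩
    have := hC (g p)
    rw [norm_iteratedFDeriv_zero] at this
    simpa using this.trans (le_abs_self C)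
  induction n generalizing W with
  | zero => exact h0 hb hbd
  | succ n ih =>
    refine hasExpGrowth_succ_iff.2 ⟨h0 hb hbd, ?_⟩
    have hD : fderiv ℝ (fun p => b (g p)) = fun p =>
        ContinuousLinearMap.compL ℝ (ℝ × E) V W (fderiv ℝ b (g p)) (fderiv ℝ g p) := by
      funext p
      exact fderiv_comp p (differentiable_of_top hb _) (differentiable_of_top hg p)
    rw [hD]
    refine HasExpGrowth.bilinear _ (ih (contDiff_fderiv_top hb) (fun m => ?_)
      fun m hm => hn m (by omega)) (hn n n.lt_succ_self)
    simpa only [norm_iteratedFDeriv_fderiv] using hbd (m + 1)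

lemma norm_le_of_linear_ode_forward {u : ℝ → V} {u' : ℝ → V} {C M ω : ℝ} (hC : 1 ≤ C)
    (hM : 0 ≤ M) (hω : 0 ≤ ω) (hu : ∀ t, HasDerivAt u (u' t) t)
    (hb : ∀ t, ‖u' t‖ ≤ C * ‖u t‖ + M * Real.exp (ω * |t|)) {t : ℝ} (ht : 0 ≤ t) :
    ‖u t‖ ≤ (‖u 0‖ + M) * Real.exp ((ω + C) * t) := by
  have key := norm_le_gronwallBound_of_norm_deriv_right_le (f := u) (f' := u') (δ := ‖u 0‖)
    (K := C) (ε := M * Real.exp (ω * t)) (a := 0) (b := t)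
    (fun s _ => (hu s).continuousAt.continuousWithinAt)
    (fun s _ => (hu s).hasDerivWithinAt) le_rfl
    (fun s hs => (hb s).trans (by
      rw [abs_of_nonneg hs.1]
      gcongr
      exact hs.2.le)) t ⟨ht, le_rfl⟩
  rw [gronwallBound_of_K_ne_0 (by positivity), sub_zero] at key
  refine key.trans ?_
  have h1 : M * Real.exp (ω * t) / C ≤ M * Real.exp (ω * t) :=
    div_le_self (by positivity) hC
  have h2 : Real.exp (C * t) ≤ Real.exp ((ω + C) * t) := by
    gcongr
    linarith
  have h3 : 0 ≤ Real.exp (C * t) - 1 := by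
    have : 1 ≤ Real.exp (C * t) := Real.one_le_exp (by positivity)
    linarith
  calc ‖u 0‖ * Real.exp (C * t) + M * Real.exp (ω * t) / C * (Real.exp (C * t) - 1)
      ≤ ‖u 0‖ * Real.exp ((ω + C) * t) + M * Real.exp (ω * t) * Real.exp (C * t) := by
        gcongr
        linarith
    _ = (‖u 0‖ + M) * Real.exp ((ω + C) * t) := by
        rw [add_mul ω, Real.exp_add]; ring

lemma norm_le_of_linear_ode {u : ℝ → V} {u' : ℝ → V} {C M ω : ℝ} (hC : 1 ≤ C)
    (hM : 0 ≤ M) (hω : 0 ≤ ω) (hu : ∀ t, HasDerivAt u (u' t) t)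
    (hb : ∀ t, ‖u' t‖ ≤ C * ‖u t‖ + M * Real.exp (ω * |t|)) (t : ℝ) :
    ‖u t‖ ≤ (‖u 0‖ + M) * Real.exp ((ω + C) * |t|) := by
  rcases le_total 0 t with ht | ht
  · rw [abs_of_nonneg ht]
    exact norm_le_of_linear_ode_forward hC hM hω hu hb ht
  · rw [abs_of_nonpos ht]
    have := norm_le_of_linear_ode_forward (u := fun s => u (-s)) (u' := fun s => -u' (-s))
      hC hM hω (fun s => by simpa [Function.comp_def] using (hu (-s)).scomp s (hasDerivAt_neg s))
      (fun s => by simpa using hb (-s)) (t := -t) (by linarith)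
    simpa using this

lemma hasDerivAt_time_slice (hg : Differentiable ℝ g) (t : ℝ) (x : E) :
    HasDerivAt (fun s => g (s, x)) (fderiv ℝ g (t, x) (1, 0)) t :=
  (hg (t, x)).hasFDerivAt.comp_hasDerivAt t ((hasDerivAt_id t).prodMk (hasDerivAt_const t x))

/-- Time and space derivatives commute. -/
lemma hasDerivAt_spatialPart_fderiv (hg : ContDiff ℝ (⊤ : ℕ∞) g)
    (hgh : ∀ t x, HasDerivAt (fun s => g (s, x)) (h (t, x)) t) (t : ℝ) (x : E) :
    HasDerivAt (fun s => spatialPart E V (fderiv ℝ g (s, x)))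
      (spatialPart E V (fderiv ℝ h (t, x))) t := by
  have hg' := differentiable_of_top (contDiff_fderiv_top hg)
  have hh : h = fun p => fderiv ℝ g p (1, 0) := by
    funext p
    exact (hgh p.1 p.2).unique (hasDerivAt_time_slice (differentiable_of_top hg) p.1 p.2)
  have key : spatialPart E V (fderiv ℝ h (t, x))
      = spatialPart E V (fderiv ℝ (fderiv ℝ g) (t, x) (1, 0)) := by
    ext v
    rw [spatialPart_apply, spatialPart_apply, hh,
      fderiv_clm_apply (hg' _) (differentiableAt_const _)]
    simpa using (hg.contDiffAt (x := (t, x))).isSymmSndFDerivAt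
      (by rw [minSmoothness_of_isRCLikeNormedField]; exact WithTop.coe_le_coe.2 (le_top : (2 : ℕ∞) ≤ ⊤)) (0, v) (1, 0)
  rw [key]
  exact (spatialPart E V).hasFDerivAt.comp_hasDerivAt t (hasDerivAt_time_slice hg' t x)

/-- The full derivative is controlled by its time and space parts. -/
lemma HasExpGrowth.fderiv_of_parts (hg : ContDiff ℝ (⊤ : ℕ∞) g)
    (hgh : ∀ t x, HasDerivAt (fun s => g (s, x)) (h (t, x)) t) (ht : HasExpGrowth n h)
    (hx : HasExpGrowth n (fun p => spatialPart E V (fderiv ℝ g p))) :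
    HasExpGrowth n (fderiv ℝ g) := by
  have hD : fderiv ℝ g = fun p =>
      ContinuousLinearMap.smulRightL ℝ (ℝ × E) V (ContinuousLinearMap.fst ℝ ℝ E) (h p) +
      (ContinuousLinearMap.compL ℝ (ℝ × E) E V).flip (ContinuousLinearMap.snd ℝ ℝ E)
        (spatialPart E V (fderiv ℝ g p)) := by
    funext p
    have hh : h p = fderiv ℝ g p (1, 0) :=
      (hgh p.1 p.2).unique (hasDerivAt_time_slice (differentiable_of_top hg) p.1 p.2)
    refine ContinuousLinearMap.ext fun q => ?_
    have hq : q = q.1 • ((1 : ℝ), (0 : E)) + (0, q.2) := by ext <;> simp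
    have : fderiv ℝ g p q = q.1 • fderiv ℝ g p (1, 0) + fderiv ℝ g p (0, q.2) := by
      conv_lhs => rw [hq]
      rw [map_add, map_smul]
    rw [this, hh]
    rfl
  rw [hD]
  exact (ht.clm_apply _).add (hx.clm_apply _)

lemma HasExpGrowth.of_linear_ode_zero {K R : ℝ × E → V} {A : ℝ × E → V →L[ℝ] V} {C : ℝ} {c : V}
    (hK : ContDiff ℝ (⊤ : ℕ∞) K) (hAC : ∀ p, ‖A p‖ ≤ C) (hR : HasExpGrowth 0 R)
    (hode : ∀ t x, HasDerivAt (fun s => K (s, x)) (A (t, x) (K (t, x)) + R (t, x)) t)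
    (hc : ∀ x, K (0, x) = c) : HasExpGrowth 0 K := by
  obtain ⟨M, ω, hM, hω, H⟩ := (hasExpGrowth_zero_iff.1 hR).2
  refine hasExpGrowth_zero_iff.2 ⟨hK, ‖c‖ + M, ω + max C 1, by positivity, by positivity,
    fun p => ?_⟩
  have := norm_le_of_linear_ode (C := max C 1) (le_max_right _ _) hM hω (fun t => hode t p.2)
    (fun t => (norm_add_le _ _).trans (add_le_add (((A (t, p.2)).le_opNorm _).trans
      (mul_le_mul_of_nonneg_right ((hAC _).trans (le_max_left _ _)) (norm_nonneg _)))
      (H (t, p.2)))) p.1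
  rwa [hc] at this

lemma norm_compL_apply_le (T : V →L[ℝ] V) : ‖ContinuousLinearMap.compL ℝ E V V T‖ ≤ ‖T‖ :=
  ContinuousLinearMap.opNorm_le_bound _ (norm_nonneg _) fun S => T.opNorm_comp_le S

lemma HasExpGrowth.precompL (B : V →L[ℝ] W →L[ℝ] Z) {g : ℝ × E → (ℝ × E) →L[ℝ] V}
    {k : ℝ × E → W} (hg : HasExpGrowth n g) (hk : HasExpGrowth n k) :
    HasExpGrowth n (fun p => B.precompL (ℝ × E) (g p) (k p)) :=
  HasExpGrowth.bilinear (V := (ℝ × E) →L[ℝ] V) (Z := (ℝ × E) →L[ℝ] Z) (B.precompL (ℝ × E)) hg hk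

lemma HasExpGrowth.compL {A : ℝ × E → V →L[ℝ] V} (hA : HasExpGrowth n A) :
    HasExpGrowth n (fun p => ContinuousLinearMap.compL ℝ E V V (A p)) :=
  HasExpGrowth.clm_apply (W := (E →L[ℝ] V) →L[ℝ] (E →L[ℝ] V))
    (ContinuousLinearMap.compL ℝ E V V) hA

/-- Solutions of a linear equation `∂_t K = A K + R` with constant initial value, bounded `A`, and
coefficients of exponential growth, are of exponential growth. -/
lemma HasExpGrowth.of_linear_ode {K R : ℝ × E → V} {A : ℝ × E → V →L[ℝ] V} {C : ℝ} {c : V}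
    (hK : ContDiff ℝ (⊤ : ℕ∞) K) (hAC : ∀ p, ‖A p‖ ≤ C) (hA : HasExpGrowth n A)
    (hR : HasExpGrowth n R)
    (hode : ∀ t x, HasDerivAt (fun s => K (s, x)) (A (t, x) (K (t, x)) + R (t, x)) t)
    (hc : ∀ x, K (0, x) = c) : HasExpGrowth n K := by
  induction n generalizing V C with
  | zero => exact .of_linear_ode_zero hK hAC hR hode hc
  | succ n ih =>
    have hA' := hasExpGrowth_succ_iff.1 hA
    have hR' := hasExpGrowth_succ_iff.1 hR
    have hKn : HasExpGrowth n K := ih hK hAC (hA.mono n.le_succ) (hR.mono n.le_succ) hode hc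
    let B : (V →L[ℝ] V) →L[ℝ] V →L[ℝ] V := .id ℝ _
    have hAK : HasExpGrowth n (fun p => A p (K p) + R p) :=
      ((hA.mono n.le_succ).bilinear B hKn).add (hR.mono n.le_succ)
    refine hasExpGrowth_succ_iff.2 ⟨hKn.mono n.zero_le, .fderiv_of_parts hK hode hAK ?_⟩
    have hR₁ : HasExpGrowth n
        (fun p => B.precompL (ℝ × E) (fderiv ℝ A p) (K p) + fderiv ℝ R p) :=
      (hA'.2.precompL B hKn).add hR'.2
    refine ih (C := C) (A := fun p => ContinuousLinearMap.compL ℝ E V V (A p)) (c := 0)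
      (R := fun p => spatialPart E V (B.precompL (ℝ × E) (fderiv ℝ A p) (K p) + fderiv ℝ R p))
      ((spatialPart E V).contDiff.comp (contDiff_fderiv_top hK))
      (fun p => (norm_compL_apply_le _).trans (hAC p))
      (hA.mono n.le_succ).compL
      (hR₁.clm_apply (spatialPart E V)) (fun t x => ?_) fun x => ?_
    · have hD := hasDerivAt_spatialPart_fderiv (h := fun p => A p (K p) + R p) hK hode t x
      have hAd := differentiable_of_top hA.1 (t, x)
      have hKd := differentiable_of_top hK (t, x)
      have hF : fderiv ℝ (fun p => A p (K p) + R p) (t, x) = B.precompR (ℝ × E) (A (t, x))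
          (fderiv ℝ K (t, x)) + B.precompL (ℝ × E) (fderiv ℝ A (t, x)) (K (t, x))
          + fderiv ℝ R (t, x) :=
        ((B.hasFDerivAt_of_bilinear hAd.hasFDerivAt hKd.hasFDerivAt).add
          (differentiable_of_top hR.1 (t, x)).hasFDerivAt).fderiv
      rw [hF, add_assoc, map_add] at hD
      exact hD
    · have h1 : HasFDerivAt (fun y => K (0, y)) (spatialPart E V (fderiv ℝ K (0, x))) x :=
        (differentiable_of_top hK (0, x)).hasFDerivAt.comp x (hasFDerivAt_prodMk_right 0 x)
      simp only [hc] at h1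
      exact h1.unique (hasFDerivAt_const c x)

/-- The first derivative of a flow is, with all its derivatives, of exponential growth. -/
lemma hasExpGrowth_fderiv_flow {a : E → E} {F : ℝ × E → E} (ha : ContDiff ℝ (⊤ : ℕ∞) a)
    (hab : ∀ n : ℕ, ∃ C : ℝ, ∀ x, ‖iteratedFDeriv ℝ n a x‖ ≤ C) (hF : ContDiff ℝ (⊤ : ℕ∞) F)
    (h0 : ∀ x, F (0, x) = x)
    (hode : ∀ t x, HasDerivAt (fun s => F (s, x)) (a (F (t, x))) t) (n : ℕ) :
    HasExpGrowth n (fderiv ℝ F) := by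
  induction n using Nat.strong_induction_on with
  | _ n ih =>
    have hab' : ∀ n : ℕ, ∃ C : ℝ, ∀ x, ‖iteratedFDeriv ℝ n (fderiv ℝ a) x‖ ≤ C := fun m => by
      simpa only [norm_iteratedFDeriv_fderiv] using hab (m + 1)
    obtain ⟨C, hC⟩ := hab' 0
    simp only [norm_iteratedFDeriv_zero] at hC
    have hA : HasExpGrowth n (fun p => fderiv ℝ a (F p)) :=
      .comp_of_bounded (contDiff_fderiv_top ha) hab' hF ih
    refine .fderiv_of_parts (h := fun p => a (F p)) hF hode (.comp_of_bounded ha hab hF ih) ?_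
    refine .of_linear_ode (C := C) (A := fun p => ContinuousLinearMap.compL ℝ E E E (fderiv ℝ a (F p)))
      (R := fun _ => 0) (c := .id ℝ E)
      ((spatialPart E E).contDiff.comp (contDiff_fderiv_top hF))
      (fun p => (norm_compL_apply_le _).trans (hC _)) hA.compL ?_
      (fun t x => ?_) fun x => ?_
    · simpa using hA.clm_apply (0 : (E →L[ℝ] E) →L[ℝ] (E →L[ℝ] E))
    · have hD := hasDerivAt_spatialPart_fderiv (h := fun p => a (F p)) hF hode t x
      have hc : fderiv ℝ (fun p => a (F p)) (t, x)
          = (fderiv ℝ a (F (t, x))).comp (fderiv ℝ F (t, x)) :=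
        fderiv_comp (t, x) (differentiable_of_top ha _) (differentiable_of_top hF _)
      rw [hc] at hD
      rw [add_zero]
      exact hD
    · have h1 : HasFDerivAt (fun y => F (0, y)) (spatialPart E E (fderiv ℝ F (0, x))) x :=
        (differentiable_of_top hF (0, x)).hasFDerivAt.comp x (hasFDerivAt_prodMk_right 0 x)
      simp only [h0] at h1
      exact h1.unique (hasFDerivAt_id x)

lemma hasExpGrowth_fderiv_of_forall (hg : ∀ n, HasExpGrowth n g) (n : ℕ) :
    HasExpGrowth n (fderiv ℝ g) :=
  (hasExpGrowth_succ_iff.1 (hg (n + 1))).2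

end

lemma pdVList_slice {F : ℝ × Ec d → Ec d} (hF : ContDiff ℝ (⊤ : ℕ∞) F)
    (hDF : ∀ n, HasExpGrowth n (fderiv ℝ F)) (l : List (Fin d)) :
    ∃ G : ℝ × Ec d → Ec d, ContDiff ℝ (⊤ : ℕ∞) G ∧ (∀ n, HasExpGrowth n (fderiv ℝ G)) ∧
      (l ≠ [] → ∀ n, HasExpGrowth n G) ∧
      ∀ t x, pdVList l (fun y => F (t, y)) x = G (t, x) := by
  induction l with
  | nil => exact ⟨F, hF, hDF, by simp, fun t x => rfl⟩
  | cons j l ih =>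
    obtain ⟨G, hG, hDG, -, hGl⟩ := ih
    have hG' : ∀ n, HasExpGrowth n fun p => fderiv ℝ G p (0, EuclideanSpace.single j 1) :=
      fun n => (hDG n).clm_apply (ContinuousLinearMap.apply ℝ (Ec d) _)
    refine ⟨_, (hG' 0).1, hasExpGrowth_fderiv_of_forall hG', fun _ => hG', fun t x => ?_⟩
    have h1 : HasFDerivAt (fun y => G (t, y)) (spatialPart _ _ (fderiv ℝ G (t, x))) x :=
      (differentiable_of_top hG (t, x)).hasFDerivAt.comp x (hasFDerivAt_prodMk_right t x)
    have h2 : pdVList l (fun y => F (t, y)) = fun y => G (t, y) := funext (hGl t)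
    change fderiv ℝ (pdVList l fun y => F (t, y)) x _ = _
    rw [h2, h1.fderiv, spatialPart_apply]

lemma iteratedDeriv_slice {F : ℝ × Ec d → Ec d} (hF : ContDiff ℝ (⊤ : ℕ∞) F)
    (hDF : ∀ n, HasExpGrowth n (fderiv ℝ F)) (k : ℕ) :
    ∃ G : ℝ × Ec d → Ec d, ContDiff ℝ (⊤ : ℕ∞) G ∧ (∀ n, HasExpGrowth n (fderiv ℝ G)) ∧
      ((k ≠ 0 ∨ ∀ n, HasExpGrowth n F) → ∀ n, HasExpGrowth n G) ∧
      ∀ t x, iteratedDeriv k (fun s => F (s, x)) t = G (t, x) := by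
  induction k with
  | zero => exact ⟨F, hF, hDF, by simp, fun t x => by simp⟩
  | succ k ih =>
    obtain ⟨G, hG, hDG, -, hGk⟩ := ih
    have hG' : ∀ n, HasExpGrowth n fun p => fderiv ℝ G p (1, 0) :=
      fun n => (hDG n).clm_apply (ContinuousLinearMap.apply ℝ (Ec d) _)
    refine ⟨_, (hG' 0).1, hasExpGrowth_fderiv_of_forall hG', fun _ => hG', fun t x => ?_⟩
    have h2 : iteratedDeriv k (fun s => F (s, x)) = fun s => G (s, x) :=
      funext fun s => hGk s x
    rw [iteratedDeriv_succ, h2, (hasDerivAt_time_slice (differentiable_of_top hG) t x).deriv]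

lemma idxList_ne_nil {α : Fin d → ℕ} (hα : ∑ i, α i ≠ 0) : idxList α ≠ [] := by
  contrapose! hα
  refine Finset.sum_eq_zero fun i _ => ?_
  simpa [idxList] using List.flatMap_eq_nil_iff.1 hα i (List.mem_finRange i)

/-- **Lemma 3.2.II of ter Elst–Robinson, "Uniform subellipticity".**
Let `X` be a `C_b^∞`-vector field on `ℝ^d` with flow `exp(tX)`.  For every multi-index `α`
and every `k ≥ 0` with `|α| + k ≥ 1` there are `M, ω > 0` such that
`|∂_t^k ∂_x^α exp(tX)(x)| ≤ M e^{ω|t|}` for all `t ∈ ℝ` and `x ∈ ℝ^d`. -/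
theorem flow_mixed_derivative_bound (d : ℕ) (a : Ec d → Ec d) (f : ℝ → Ec d → Ec d)
    (ha : IsCbVF a) (hf : IsFlowOf a f)
    (α : Fin d → ℕ) (k : ℕ) (hαk : 1 ≤ (∑ i, α i) + k) :
    ∃ M ω : ℝ, 0 < M ∧ 0 < ω ∧ ∀ (t : ℝ) (x : Ec d),
      ‖iteratedDeriv k (fun s => pdVMulti α (fun y => f s y) x) t‖ ≤
        M * Real.exp (ω * |t|) := by
  obtain ⟨hF, h0, hode⟩ := hf
  have hDF := hasExpGrowth_fderiv_flow ha.1 ha.2 hF h0 hode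
  obtain ⟨G, hG, hDG, hGα, hGeq⟩ := pdVList_slice hF hDF (idxList α)
  obtain ⟨H, -, -, hH, hHeq⟩ := iteratedDeriv_slice hG hDG k
  have hHgrowth : HasExpGrowth 0 H := by
    refine hH ?_ 0
    rcases Nat.eq_zero_or_pos k with hk | hk
    · exact .inr (hGα (idxList_ne_nil (by omega)))
    · exact .inl hk.ne'
  obtain ⟨M, ω, hM, hω, hb⟩ := (hasExpGrowth_zero_iff.1 hHgrowth).2
  refine ⟨M + 1, ω + 1, by positivity, by positivity, fun t x => ?_⟩
  have heq : (fun s => pdVMulti α (fun y => f s y) x) = fun s => G (s, x) :=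
    funext fun s => hGeq s x
  rw [heq, hHeq]
  refine (hb (t, x)).trans ?_
  gcongr <;> linarith

end
end

section
/- Let X be a C_b^∞-vector field on ℝ^d. Then there are M, ω > 0 such that ‖e^{tX}φ‖₂ ≤ M e^{ω|t|} ‖φ‖₂ for all t ∈ ℝ and all φ ∈ C_c^∞(ℝ^d), where (e^{tX}φ)(x) = φ(exp(tX)(x)) and ‖·‖₂ is the L²(ℝ^d) norm. -/
open MeasureTheory Complex Real Finset

noncomputable section

variable {d : ℕ}

open scoped NNReal ENNReal

/-- An antilipschitz map of `ℝ^d` pulls Lebesgue measure back with the expected constant. -/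
lemma AntilipschitzWith.volume_preimage_le {g : Ec d → Ec d} {K : ℝ≥0}
    (hg : AntilipschitzWith K g) (s : Set (Ec d)) :
    volume (g ⁻¹' s) ≤ ((K ^ d : ℝ≥0) : ℝ≥0∞) * volume s := by
  have : Measure.IsAddHaarMeasure (Measure.hausdorffMeasure (X := Ec d) (d : ℝ)) := by
    simpa using isAddHaarMeasure_hausdorffMeasure (E := Ec d)
  rw [Measure.isAddLeftInvariant_eq_smul (volume : Measure (Ec d))
    (Measure.hausdorffMeasure (d : ℝ))]
  simp only [Measure.smul_apply, ENNReal.smul_def, smul_eq_mul]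
  calc _ ≤ _ * ((K : ℝ≥0∞) ^ (d : ℝ) * Measure.hausdorffMeasure (d : ℝ) s) := by
        gcongr
        exact hg.hausdorffMeasure_preimage_le d.cast_nonneg s
    _ = _ := by
        rw [ENNReal.rpow_natCast]
        push_cast
        ring

lemma AntilipschitzWith.integral_comp_le {g : Ec d → Ec d} {K : ℝ≥0}
    (hg : AntilipschitzWith K g) (hgc : Continuous g) {h : Ec d → ℝ} (h_nonneg : 0 ≤ h)
    (hc : Continuous h) (hi : Integrable h) :
    ∫ x, h (g x) ≤ (K : ℝ) ^ d * ∫ x, h x := by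
  have hle : Measure.map g volume ≤ (K ^ d : ℝ≥0) • (volume : Measure (Ec d)) := by
    refine Measure.le_iff.2 fun s hs => ?_
    rw [Measure.map_apply hgc.measurable hs]
    exact hg.volume_preimage_le s
  rw [← integral_map hgc.aemeasurable hc.aestronglyMeasurable]
  refine (integral_mono_measure hle (.of_forall h_nonneg) hi.smul_measure_nnreal).trans_eq ?_
  simp [integral_smul_nnreal_measure, NNReal.smul_def]

lemma IsCbVF.exists_lipschitzWith {a : Ec d → Ec d} (ha : IsCbVF a) :
    ∃ K : ℝ≥0, LipschitzWith K a := by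
  obtain ⟨C, hC⟩ := ha.2 1
  refine ⟨C.toNNReal, lipschitzWith_of_nnnorm_fderiv_le (ha.1.differentiable (by simp))
    fun x => ?_⟩
  rw [← NNReal.coe_le_coe, coe_nnnorm, ← norm_iteratedFDeriv_one]
  exact (hC x).trans C.le_coe_toNNReal

/-- Grönwall's inequality, applied to the flow run backwards from time `t` to time `0`. -/
lemma IsFlowOf.antilipschitzWith {a : Ec d → Ec d} {f : ℝ → Ec d → Ec d} (hf : IsFlowOf a f)
    {K : ℝ≥0} (hK : LipschitzWith K a) (t : ℝ) :
    AntilipschitzWith (Real.exp (K * |t|)).toNNReal (f t) := by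
  refine AntilipschitzWith.of_le_mul_dist fun x y => ?_
  have hd : ∀ z s, HasDerivAt (fun s => f (t - t * s) z) ((-t) • a (f (t - t * s) z)) s := by
    intro z s
    have h : HasDerivAt (fun s : ℝ => t - t * s) (-t) s := by
      simpa using ((hasDerivAt_id s).const_mul t).const_sub t
    exact (hf.2.2 (t - t * s) z).scomp s h
  have hv : LipschitzWith (‖-t‖₊ * K) fun z => (-t) • a z :=
    (lipschitzWith_smul (-t)).comp hK
  have hcont : ∀ z, Continuous fun s => f (t - t * s) z := fun z =>
    continuous_iff_continuousAt.2 fun s => (hd z s).continuousAt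
  have := dist_le_of_trajectories_ODE (v := fun _ z => (-t) • a z) (fun _ => hv)
    (hcont x).continuousOn (fun s _ => (hd x s).hasDerivWithinAt)
    (hcont y).continuousOn (fun s _ => (hd y s).hasDerivWithinAt)
    le_rfl 1 (Set.right_mem_Icc.2 zero_le_one)
  simp only [mul_one, sub_self, mul_zero, sub_zero, hf.2.1] at this
  rw [Real.coe_toNNReal _ (Real.exp_nonneg _), mul_comm]
  simpa [mul_comm] using this

/-- **Lemma 3.2.III of ter Elst–Robinson, "Uniform subellipticity".**
Let `X` be a `C_b^∞`-vector field on `ℝ^d` with flow `exp(tX)`.  Then there are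
`M, ω > 0` such that `‖e^{tX}φ‖₂ ≤ M e^{ω|t|} ‖φ‖₂` for all `t ∈ ℝ` and
`φ ∈ C_c^∞(ℝ^d)`, where `(e^{tX}φ)(x) = φ(exp(tX)(x))`. -/
theorem flow_L2_growth_bound (d : ℕ) (a : Ec d → Ec d) (f : ℝ → Ec d → Ec d)
    (ha : IsCbVF a) (hf : IsFlowOf a f) :
    ∃ M ω : ℝ, 0 < M ∧ 0 < ω ∧ ∀ (t : ℝ) (φ : Ec d → ℂ), IsCc φ →
      l2norm (fun x => φ (f t x)) ≤ M * Real.exp (ω * |t|) * l2norm φ := by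
  obtain ⟨K, hK⟩ := ha.exists_lipschitzWith
  refine ⟨1, K * d / 2 + 1, one_pos, by positivity, fun t φ hφ => ?_⟩
  have hφc : Continuous φ := hφ.1.continuous
  have hft : Continuous (f t) := hf.1.continuous.comp (by fun_prop : Continuous fun x => (t, x))
  have hc : Continuous fun x => ‖φ x‖ ^ 2 := by fun_prop
  have hs : HasCompactSupport fun x => ‖φ x‖ ^ 2 :=
    hφ.2.comp_left (g := fun z => ‖z‖ ^ 2) (by simp)
  have hI := (hf.antilipschitzWith hK t).integral_comp_le hft (h := fun x => ‖φ x‖ ^ 2)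
    (fun x => by positivity) hc (hc.integrable_of_hasCompactSupport hs)
  rw [Real.coe_toNNReal _ (Real.exp_nonneg _)] at hI
  have hexp : Real.exp (K * |t|) ^ d ≤ Real.exp ((K * d / 2 + 1) * |t|) ^ 2 := by
    rw [← Real.exp_nat_mul, ← Real.exp_nat_mul, Real.exp_le_exp]
    push_cast
    linarith [abs_nonneg t]
  have h_nonneg : 0 ≤ ∫ x, ‖φ x‖ ^ 2 := integral_nonneg fun x => by positivity
  rw [one_mul]
  refine Real.sqrt_le_iff.2 ⟨by unfold l2norm; positivity, ?_⟩
  rw [mul_pow, l2norm, Real.sq_sqrt h_nonneg]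
  exact hI.trans (mul_le_mul_of_nonneg_right hexp h_nonneg)

end
end

section
/- Let Y₁ and Y₂ be C_b^∞-vector fields on ℝ^d and let N ≥ 2 be an integer. Then there exist c > 0 and C_b^∞-vector fields Z₂, …, Z_N, where each Z_j is a real linear combination of iterated commutators Y_{[α]} of Y₁, Y₂ of length |α| = j, such that |exp(t(Y₁+Y₂)) ( exp(−tY₁) ( exp(−tY₂) ( exp(−t²Z₂) ( ⋯ ( exp(−t^N Z_N)(x) ) ⋯ )))) − x| ≤ c |t|^{N+1} uniformly for all x ∈ ℝ^d and t ∈ [−1,1]. -/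
open MeasureTheory Complex Real Finset

noncomputable section

variable {d : ℕ}

/-- The commutator `[X,Y]` of vector fields, as coefficient maps:
`[X,Y] = ∑_k (X b_k - Y a_k) ∂_k`. -/
def vfComm (a b : Ec d → Ec d) : Ec d → Ec d :=
  fun x => fderiv ℝ b x (a x) - fderiv ℝ a x (b x)

/-- The iterated commutator `X_{[α]} = [X_{i₁},[X_{i₂},…,[X_{i_{n-1}},X_{i_n}]…]]`
associated with a multi-index `α` given as a list. -/
def multiComm {ι : Type*} (X : ι → Ec d → Ec d) : List ι → (Ec d → Ec d)
  | [] => fun _ => 0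
  | [i] => X i
  | i :: j :: l => vfComm (X i) (multiComm X (j :: l))

/-- A smooth map which is bounded together with all its iterated derivatives. -/
def CbSmooth {E F : Type*} [NormedAddCommGroup E] [NormedSpace ℝ E]
    [NormedAddCommGroup F] [NormedSpace ℝ F] (a : E → F) : Prop :=
  ContDiff ℝ (⊤ : ℕ∞) a ∧ ∀ n : ℕ, ∃ C : ℝ, ∀ x, ‖iteratedFDeriv ℝ n a x‖ ≤ C

section CbSmooth

variable {E F : Type*} [NormedAddCommGroup E] [NormedSpace ℝ E]
  [NormedAddCommGroup F] [NormedSpace ℝ F]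

namespace CbSmooth

lemma differentiable {a : E → F} (ha : CbSmooth a) : Differentiable ℝ a :=
  ha.1.differentiable (by simp)

lemma fderiv {a : E → F} (ha : CbSmooth a) : CbSmooth (fderiv ℝ a) := by
  refine ⟨ha.1.fderiv_right (by simp), fun n => ?_⟩
  obtain ⟨C, hC⟩ := ha.2 (n + 1)
  exact ⟨C, fun x => by rw [norm_iteratedFDeriv_fderiv]; exact hC x⟩

lemma exists_norm_le {a : E → F} (ha : CbSmooth a) : ∃ C : ℝ, 0 ≤ C ∧ ∀ x, ‖a x‖ ≤ C := by
  obtain ⟨C, hC⟩ := ha.2 0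
  have h : ∀ x, ‖a x‖ ≤ C := fun x => by simpa using hC x
  exact ⟨C, (norm_nonneg _).trans (h 0), h⟩

lemma exists_lipschitzWith {a : E → F} (ha : CbSmooth a) :
    ∃ K : NNReal, LipschitzWith K a := by
  obtain ⟨C, hC0, hC⟩ := ha.fderiv.exists_norm_le
  exact ⟨⟨C, hC0⟩, lipschitzWith_of_nnnorm_fderiv_le ha.differentiable hC⟩

lemma exists_norm_sub_sub_le {a : E → F} (ha : CbSmooth a) :
    ∃ C : ℝ, 0 ≤ C ∧ ∀ x h, ‖a (x + h) - a x - _root_.fderiv ℝ a x h‖ ≤ C * ‖h‖ * ‖h‖ := by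
  obtain ⟨K, hK⟩ := ha.fderiv.exists_lipschitzWith
  refine ⟨K, K.2, fun x h => ?_⟩
  have := (convex_closedBall x ‖h‖).norm_image_sub_le_of_norm_hasFDerivWithin_le'
    (f := a) (f' := _root_.fderiv ℝ a) (φ := _root_.fderiv ℝ a x) (C := K * ‖h‖) (x := x)
    (y := x + h) (fun y _ => (ha.differentiable y).hasFDerivAt.hasFDerivWithinAt)
    (fun y hy => ?_) (by simp) (by simp)
  · simpa using this
  · refine (hK.norm_sub_le y x).trans ?_
    gcongr
    simpa [dist_eq_norm] using hy

lemma add {a b : E → F} (ha : CbSmooth a) (hb : CbSmooth b) :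
    CbSmooth (fun x => a x + b x) := by
  refine ⟨ha.1.add hb.1, fun n => ?_⟩
  obtain ⟨A, hA⟩ := ha.2 n
  obtain ⟨B, hB⟩ := hb.2 n
  refine ⟨A + B, fun x => ?_⟩
  rw [fun_iteratedFDeriv_add_apply (ha.1.contDiffAt.of_le (by exact_mod_cast le_top))
    (hb.1.contDiffAt.of_le (by exact_mod_cast le_top))]
  exact (norm_add_le _ _).trans (add_le_add (hA x) (hB x))

lemma clm_apply {A : E → E →L[ℝ] F} {a : E → E} (hA : CbSmooth A) (ha : CbSmooth a) :
    CbSmooth (fun x => A x (a x)) := by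
  refine ⟨hA.1.clm_apply ha.1, fun n => ?_⟩
  choose B hB using hA.2
  choose C hC using ha.2
  refine ⟨∑ i ∈ Finset.range (n + 1), (n.choose i : ℝ) * B i * C (n - i), fun x => ?_⟩
  refine (norm_iteratedFDeriv_clm_apply hA.1 ha.1 x (n := n) (by exact_mod_cast le_top)).trans ?_
  refine Finset.sum_le_sum fun i _ => ?_
  have := (norm_nonneg _).trans (hB i x)
  gcongr
  · exact hB i x
  · exact hC _ x

lemma const_smul {a : E → F} (c : ℝ) (ha : CbSmooth a) : CbSmooth (fun x => c • a x) := by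
  refine ⟨ha.1.const_smul c, fun n => ?_⟩
  obtain ⟨A, hA⟩ := ha.2 n
  refine ⟨‖c‖ * A, fun x => ?_⟩
  rw [iteratedFDeriv_const_smul_apply' (ha.1.contDiffAt.of_le (by exact_mod_cast le_top)),
    norm_smul]
  gcongr
  exact hA x

lemma zero : CbSmooth (fun _ : E => (0 : F)) :=
  ⟨contDiff_const, fun n => ⟨0, fun x => by simp⟩⟩

end CbSmooth

end CbSmooth

section Superposition

variable {X : Type*} [TopologicalSpace X] [CompactSpace X]

/-- Pointwise application of a continuous family of operators, as a bounded bilinear map. -/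
def pointwiseApply (X E F : Type*) [TopologicalSpace X] [CompactSpace X] [NormedAddCommGroup E]
    [NormedSpace ℝ E] [NormedAddCommGroup F] [NormedSpace ℝ F] :
    C(X, E →L[ℝ] F) →L[ℝ] C(X, E) →L[ℝ] C(X, F) :=
  LinearMap.mkContinuous₂
    (LinearMap.mk₂ ℝ (fun (A : C(X, E →L[ℝ] F)) (α : C(X, E)) =>
        (⟨fun s => A s (α s), by fun_prop⟩ : C(X, F)))
      (fun _ _ _ => by ext; simp) (fun _ _ _ => by ext; simp)
      (fun _ _ _ => by ext; simp) (fun _ _ _ => by ext; simp)) 1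
    (fun A α => by
      rw [ContinuousMap.norm_le _ (by positivity)]
      intro s
      simp only [LinearMap.mk₂_apply, ContinuousMap.coe_mk, one_mul]
      exact (A s).le_of_opNorm_le_of_le (A.norm_coe_le_norm s) (α.norm_coe_le_norm s))

/-- The superposition operator `α ↦ a ∘ α`. -/
def superposition (X : Type*) [TopologicalSpace X] {E F : Type*} [NormedAddCommGroup E]
    [NormedSpace ℝ E] [NormedAddCommGroup F] [NormedSpace ℝ F] (a : E → F)
    (ha : CbSmooth a) (α : C(X, E)) : C(X, F) :=
  ⟨fun s => a (α s), ha.1.continuous.comp α.continuous⟩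

universe u

lemma hasFDerivAt_superposition {E F : Type*} [NormedAddCommGroup E] [NormedSpace ℝ E]
    [NormedAddCommGroup F] [NormedSpace ℝ F] {a : E → F} (ha : CbSmooth a) (α : C(X, E)) :
    HasFDerivAt (superposition X a ha) (pointwiseApply X E F (superposition X _ ha.fderiv α)) α := by
  obtain ⟨C, hC0, hC⟩ := ha.exists_norm_sub_sub_le
  rw [hasFDerivAt_iff_isLittleO_nhds_zero]
  refine Asymptotics.IsBigO.trans_isLittleO (g := fun h : C(X, E) => ‖h‖ * ‖h‖) ?_ ?_
  · refine Asymptotics.IsBigO.of_bound C (Filter.Eventually.of_forall fun h => ?_)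
    rw [ContinuousMap.norm_le _ (by positivity)]
    intro s
    refine (hC (α s) (h s)).trans ?_
    have := h.norm_coe_le_norm s
    rw [norm_mul, norm_norm, ← mul_assoc]
    gcongr
  · have : (fun h : C(X, E) => ‖h‖) =o[nhds 0] (fun _ => (1 : ℝ)) :=
      (Asymptotics.isLittleO_one_iff ℝ).2 (by simpa using (continuous_norm (E := C(X, E))).tendsto 0)
    refine Asymptotics.isLittleO_norm_right.1 ?_
    simpa using this.mul_isBigO (Asymptotics.isBigO_refl (fun h : C(X, E) => ‖h‖) _)

lemma contDiff_superposition {E : Type u} [NormedAddCommGroup E] [NormedSpace ℝ E] :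
    ∀ {F : Type u} [NormedAddCommGroup F] [NormedSpace ℝ F] {a : E → F} (ha : CbSmooth a),
    ContDiff ℝ (⊤ : ℕ∞) (superposition X a ha) := by
  suffices H : ∀ n : ℕ, ∀ {F : Type u} [NormedAddCommGroup F] [NormedSpace ℝ F] {a : E → F}
      (ha : CbSmooth a), ContDiff ℝ n (superposition X a ha) by
    intro F _ _ a ha
    exact contDiff_infty.2 fun n => H n ha
  intro n
  induction n with
  | zero =>
    intro F _ _ a ha
    exact contDiff_zero.2 (continuous_iff_continuousAt.2 fun α =>
      (hasFDerivAt_superposition ha α).continuousAt)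
  | succ n ih =>
    intro F _ _ a ha
    have h := (pointwiseApply X E F).contDiff.comp (ih ha.fderiv)
    push_cast
    exact contDiff_succ_iff_hasFDerivAt.2 ⟨_, h, hasFDerivAt_superposition ha⟩

lemma lipschitzWith_superposition {E F : Type*} [NormedAddCommGroup E] [NormedSpace ℝ E]
    [NormedAddCommGroup F] [NormedSpace ℝ F] {a : E → F} (ha : CbSmooth a) {K : NNReal}
    (hK : LipschitzWith K a) : LipschitzWith K (superposition X a ha) := by
  refine LipschitzWith.of_dist_le_mul fun α β => ?_
  rw [ContinuousMap.dist_le (by positivity)]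
  intro s
  refine (hK.dist_le_mul _ _).trans ?_
  gcongr
  exact ContinuousMap.dist_apply_le_dist s

end Superposition

section Flow

universe u

variable {E : Type u} [NormedAddCommGroup E] [NormedSpace ℝ E]

/-- `f` consists of the globally defined integral curves of `a`. -/
structure IsGlobalFlow (a : E → E) (f : ℝ → E → E) : Prop where
  zero_apply : ∀ x, f 0 x = x
  hasDerivAt : ∀ t x, HasDerivAt (fun s => f s x) (a (f t x)) t

lemma eq_of_hasDerivAt_of_lipschitzWith {a : E → E} {K : NNReal} (hK : LipschitzWith K a)
    {γ δ : ℝ → E} (hγ : ∀ t, HasDerivAt γ (a (γ t)) t) (hδ : ∀ t, HasDerivAt δ (a (δ t)) t)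
    {t₀ : ℝ} (h : γ t₀ = δ t₀) : γ = δ :=
  ODE_solution_unique_univ (v := fun _ => a) (s := fun _ => Set.univ) (K := K)
    (fun _ => hK.lipschitzOnWith) (fun t => ⟨hγ t, trivial⟩) (fun t => ⟨hδ t, trivial⟩) h

namespace IsGlobalFlow

lemma add_apply {a : E → E} {f : ℝ → E → E} (hf : IsGlobalFlow a f) {K : NNReal}
    (hK : LipschitzWith K a) (s t : ℝ) (x : E) : f (s + t) x = f s (f t x) := by
  have := eq_of_hasDerivAt_of_lipschitzWith hK (γ := fun s => f (s + t) x)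
    (δ := fun s => f s (f t x)) (t₀ := 0) (fun s => (hf.hasDerivAt (s + t) x).comp_add_const s t)
    (fun s => hf.hasDerivAt s _) (by simp [hf.zero_apply])
  exact congrFun this s

lemma neg_apply_apply {a : E → E} {f : ℝ → E → E} (hf : IsGlobalFlow a f) {K : NNReal}
    (hK : LipschitzWith K a) (t : ℝ) (x : E) : f (-t) (f t x) = x := by
  rw [← hf.add_apply hK, neg_add_cancel, hf.zero_apply]

lemma reverse {a : E → E} {f : ℝ → E → E} (hf : IsGlobalFlow a f) :
    IsGlobalFlow (fun x => -a x) (fun t => f (-t)) :=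
  ⟨by simp [hf.zero_apply], fun t x => by
    simpa [Function.comp_def] using (hf.hasDerivAt (-t) x).scomp t (hasDerivAt_neg t)⟩

lemma dist_le {a : E → E} {f : ℝ → E → E} (hf : IsGlobalFlow a f) {K : NNReal}
    (hK : LipschitzWith K a) (t : ℝ) (x y : E) :
    dist (f t x) (f t y) ≤ dist x y * Real.exp (K * |t|) := by
  have key : ∀ {a : E → E} {f : ℝ → E → E}, IsGlobalFlow a f → LipschitzWith K a →
      ∀ t : ℝ, 0 ≤ t → dist (f t x) (f t y) ≤ dist x y * Real.exp (K * t) := by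
    intro a f hf hK t ht
    have hc : ∀ x, Continuous fun s => f s x := fun x =>
      continuous_iff_continuousAt.2 fun s => (hf.hasDerivAt s x).continuousAt
    have := dist_le_of_trajectories_ODE (v := fun _ => a) (K := K) (f := fun s => f s x)
      (g := fun s => f s y) (a := 0) (b := t) (δ := dist x y) (fun _ => hK) (hc x).continuousOn
      (fun s _ => (hf.hasDerivAt s x).hasDerivWithinAt) (hc y).continuousOn
      (fun s _ => (hf.hasDerivAt s y).hasDerivWithinAt) (by simp [hf.zero_apply]) t ⟨ht, le_rfl⟩
    simpa using this
  rcases le_total 0 t with ht | ht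
  · rw [abs_of_nonneg ht]
    exact key hf hK t ht
  · rw [abs_of_nonpos ht]
    have hK' : LipschitzWith K (fun x => -a x) := hK.neg
    simpa using key hf.reverse hK' (-t) (by linarith)

lemma continuous_uncurry {a : E → E} {f : ℝ → E → E} (hf : IsGlobalFlow a f) {K : NNReal}
    (hK : LipschitzWith K a) : Continuous fun p : ℝ × E => f p.1 p.2 := by
  rw [continuous_iff_continuousAt]
  rintro ⟨t, x⟩
  rw [ContinuousAt, tendsto_iff_dist_tendsto_zero]
  have h1 : Filter.Tendsto (fun p : ℝ × E => dist p.2 x * Real.exp (K * |p.1|)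
      + dist (f p.1 x) (f t x)) (nhds (t, x)) (nhds 0) := by
    have hc : Continuous fun s => f s x :=
      continuous_iff_continuousAt.2 fun s => (hf.hasDerivAt s x).continuousAt
    have : Continuous (fun p : ℝ × E => dist p.2 x * Real.exp (K * |p.1|)
      + dist (f p.1 x) (f t x)) := by fun_prop
    simpa using this.tendsto (t, x)
  refine squeeze_zero (fun _ => dist_nonneg) (fun p => ?_) h1
  exact (dist_triangle _ (f p.1 x) _).trans (by gcongr; exact hf.dist_le hK _ _ _)

end IsGlobalFlow

lemma exists_isGlobalFlow [CompleteSpace E] {a : E → E} (ha : CbSmooth a) :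
    ∃ f, IsGlobalFlow a f := by
  obtain ⟨K, hK⟩ := ha.exists_lipschitzWith
  obtain ⟨L, hL0, hL⟩ := ha.exists_norm_le
  have hsol : ∀ (x : E) (T : ℝ), 0 < T → ∃ α : ℝ → E, α 0 = x ∧
      ∀ t ∈ Set.Ioo (-T) T, HasDerivAt α (a (α t)) t := by
    intro x T hT
    have hPL : IsPicardLindelof (fun _ => a) (tmin := -T) (tmax := T) ⟨0, by constructor <;> linarith⟩
        x (⟨L * T, by positivity⟩) 0 ⟨L, hL0⟩ K :=
      .of_time_independent (fun y _ => hL y) hK.lipschitzOnWith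
        (by simp only [sub_zero, zero_sub, neg_neg, max_self, NNReal.coe_zero]; exact le_rfl)
    obtain ⟨α, h0, hα⟩ := hPL.exists_eq_forall_mem_Icc_hasDerivWithinAt₀
    exact ⟨α, h0, fun t ht => (hα t ⟨ht.1.le, ht.2.le⟩).hasDerivAt (Icc_mem_nhds ht.1 ht.2)⟩
  choose! α hα0 hα using hsol
  have hmono : ∀ x T T' t, |t| < T → T ≤ T' → α x T t = α x T' t := by
    intro x T T' t ht hTT
    have hT : 0 < T := (abs_nonneg t).trans_lt ht
    have := ODE_solution_unique_of_mem_Ioo (v := fun _ => a) (K := K) (s := fun _ => Set.univ)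
      (a := -T) (b := T) (t₀ := 0) (f := α x T) (g := α x T') (fun _ _ => hK.lipschitzOnWith)
      ⟨by linarith, hT⟩ (fun s hs => ⟨hα x T hT s hs, trivial⟩)
      (fun s hs => ⟨hα x T' (by linarith) s ⟨by linarith [hs.1], by linarith [hs.2]⟩, trivial⟩)
      (by rw [hα0 x T hT, hα0 x T' (by linarith)])
    exact this (abs_lt.1 ht)
  have heq : ∀ x T T' t, |t| < T → |t| < T' → α x T t = α x T' t := fun x T T' t h h' =>
    (le_total T T').elim (fun H => hmono x T T' t h H) (fun H => (hmono x T' T t h' H).symm)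
  refine ⟨fun t x => α x (|t| + 1) t, fun x => hα0 x _ (by positivity), fun t x => ?_⟩
  have h1 := hα x (|t| + 1) (by positivity) t (abs_lt.1 (by linarith))
  refine h1.congr_of_eventuallyEq ?_
  have : ∀ᶠ s in nhds t, |s| < |t| + 1 :=
    (continuous_abs.tendsto t).eventually (gt_mem_nhds (by linarith))
  filter_upwards [this] with s hs
  exact heq _ _ _ _ (by linarith) hs

/-- The Volterra operator `α ↦ ∫₀ˢ α` on `C([0,1], E)`. -/
def volterra (E : Type*) [NormedAddCommGroup E] [NormedSpace ℝ E] :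
    C(unitInterval, E) →L[ℝ] C(unitInterval, E) :=
  LinearMap.mkContinuous
    { toFun := fun α => ⟨fun s => ∫ τ in (0 : ℝ)..s, Set.IccExtend zero_le_one α τ,
        (intervalIntegral.continuous_primitive
          (fun _ _ => (α.continuous.Icc_extend').intervalIntegrable _ _) 0).comp
          continuous_subtype_val⟩
      map_add' := fun α β => by
        ext s
        exact intervalIntegral.integral_add
          ((α.continuous.Icc_extend').intervalIntegrable _ _)
          ((β.continuous.Icc_extend').intervalIntegrable _ _)
      map_smul' := fun c α => by
        ext s
        exact intervalIntegral.integral_smul _ _ } 1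
    (fun α => by
      rw [ContinuousMap.norm_le _ (by positivity)]
      intro s
      refine (intervalIntegral.norm_integral_le_of_norm_le_const (C := ‖α‖)
        fun τ _ => α.norm_coe_le_norm _).trans ?_
      have h0 := s.2.1
      have h1 := s.2.2
      rw [sub_zero, abs_of_nonneg h0, one_mul]
      exact mul_le_of_le_one_right (norm_nonneg _) h1)

lemma volterra_apply (α : C(unitInterval, E)) (s : unitInterval) :
    volterra E α s = ∫ τ in (0 : ℝ)..s, Set.IccExtend zero_le_one α τ := rfl

lemma norm_volterra_le : ‖volterra E‖ ≤ 1 := LinearMap.mkContinuous_norm_le _ zero_le_one _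

lemma isInvertible_one_sub_of_norm_lt_one {E : Type*} [NormedAddCommGroup E] [NormedSpace ℝ E]
    [CompleteSpace E] {A : E →L[ℝ] E} (hA : ‖A‖ < 1) :
    (ContinuousLinearMap.id ℝ E - A).IsInvertible :=
  ⟨ContinuousLinearEquiv.unitsEquiv ℝ E (Units.oneSub A hA), rfl⟩

/-- The flow over a short time `t` is obtained from the solution operator in `C([0,1], E)` of the
rescaled equation `α(s) = x + t ∫₀ˢ a(α)`, which is smooth by the implicit function theorem. -/
lemma IsGlobalFlow.contDiffAt_of_abs_mul_lt_one [CompleteSpace E] {a : E → E} {f : ℝ → E → E}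
    (hf : IsGlobalFlow a f) (ha : CbSmooth a) {K : NNReal} (hK : LipschitzWith K a) {t : ℝ}
    (ht : |t| * K < 1) (x : E) :
    ContDiffAt ℝ (⊤ : ℕ∞) (fun p : ℝ × E => f p.1 p.2) (t, x) := by
  let N := superposition unitInterval a ha
  have hN : ContDiff ℝ (⊤ : ℕ∞) N := contDiff_superposition ha
  let cst : E →L[ℝ] C(unitInterval, E) := ContinuousLinearMap.const ℝ unitInterval
  let G : (ℝ × E) × C(unitInterval, E) → C(unitInterval, E) := fun q =>
    q.2 - cst q.1.2 - q.1.1 • volterra E (N q.2)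
  have hG : ContDiff ℝ (⊤ : ℕ∞) G := by
    have : ContDiff ℝ (⊤ : ℕ∞) fun q : (ℝ × E) × C(unitInterval, E) => N q.2 :=
      hN.comp contDiff_snd
    fun_prop
  let A : C(ℝ × E, C(unitInterval, E)) := ContinuousMap.curry
    (⟨fun q => f (q.1.1 * q.2) q.1.2, (hf.continuous_uncurry hK).comp
      (f := fun q : (ℝ × E) × unitInterval => (q.1.1 * (q.2 : ℝ), q.1.2)) (by fun_prop)⟩ :
      C((ℝ × E) × unitInterval, E))
  have hA : ∀ p s, A p s = f (p.1 * s) p.2 := fun _ _ => rfl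
  have hGA : ∀ p, G (p, A p) = 0 := by
    intro p
    ext s
    have h1 : ∀ τ : ℝ, HasDerivAt (fun τ => f (p.1 * τ) p.2) (p.1 • a (f (p.1 * τ) p.2)) τ :=
      fun τ => (hf.hasDerivAt (p.1 * τ) p.2).scomp τ (by simpa using (hasDerivAt_id τ).const_mul p.1)
    have h2 : Continuous fun τ : ℝ => f (p.1 * τ) p.2 :=
      continuous_iff_continuousAt.2 fun τ => (h1 τ).continuousAt
    have h3 := intervalIntegral.integral_eq_sub_of_hasDerivAt (a := 0) (b := s)
      (fun τ _ => h1 τ) ((continuous_const.smul (hK.continuous.comp h2)).intervalIntegrable _ _)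
    have h4 : volterra E (N (A p)) s = ∫ τ in (0 : ℝ)..s, a (f (p.1 * τ) p.2) := by
      rw [volterra_apply]
      refine intervalIntegral.integral_congr fun τ hτ => ?_
      rw [Set.uIcc_of_le s.2.1] at hτ
      rw [Set.IccExtend_of_mem _ _ ⟨hτ.1, hτ.2.trans s.2.2⟩]
      rfl
    rw [intervalIntegral.integral_smul, ← h4] at h3
    change A p s - p.2 - p.1 • volterra E (N (A p)) s = 0
    rw [h3, hA]
    simp [hf.zero_apply]
  set u : (ℝ × E) × C(unitInterval, E) := ((t, x), A (t, x)) with hu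
  have hinv : (fderiv ℝ G u ∘L .inr ℝ (ℝ × E) C(unitInterval, E)).IsInvertible := by
    have h1 : HasFDerivAt (fun β => G ((t, x), β))
        (fderiv ℝ G u ∘L .inr ℝ (ℝ × E) C(unitInterval, E)) (A (t, x)) :=
      HasFDerivAt.comp (A (t, x)) ((hG.differentiable (by simp)) u).hasFDerivAt
        (hasFDerivAt_prodMk_right (t, x) (A (t, x)))
    have h2 : HasFDerivAt (fun β => G ((t, x), β))
        (ContinuousLinearMap.id ℝ _ - t • (volterra E ∘L fderiv ℝ N (A (t, x)))) (A (t, x)) :=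
      ((hasFDerivAt_id (A (t, x))).sub_const (cst x)).sub
        ((((volterra E).hasFDerivAt.comp (A (t, x))
          ((hN.differentiable (by simp)) (A (t, x))).hasFDerivAt)).const_smul t)
    rw [h1.unique h2]
    refine isInvertible_one_sub_of_norm_lt_one (lt_of_le_of_lt ?_ ht)
    rw [norm_smul, Real.norm_eq_abs]
    gcongr
    refine (ContinuousLinearMap.opNorm_comp_le _ _).trans ?_
    have h3 : ‖fderiv ℝ N (A (t, x))‖ ≤ K :=
      norm_fderiv_le_of_lipschitz ℝ (lipschitzWith_superposition ha hK)
    calc ‖volterra E‖ * ‖fderiv ℝ N (A (t, x))‖ ≤ 1 * K := by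
          gcongr
          exact norm_volterra_le
      _ = K := one_mul _
  have hn : ((⊤ : ℕ∞) : WithTop ℕ∞) ≠ 0 := by simp
  have hGu : ContDiffAt ℝ (⊤ : ℕ∞) G u := hG.contDiffAt
  have h1 := hGu.eventually_apply_eq_iff_implicitFunction hn hinv
  have h2 : Filter.Tendsto (fun p => (p, A p)) (nhds (t, x)) (nhds u) :=
    (continuous_id.prodMk A.continuous).tendsto (t, x)
  have h3 : A =ᶠ[nhds (t, x)] hGu.implicitFunction hn hinv := by
    filter_upwards [h2.eventually h1] with p hp
    exact (hp.1 ((hGA p).trans (hGA (t, x)).symm)).symm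
  have h4 : ContDiffAt ℝ (⊤ : ℕ∞) A (t, x) :=
    (hGu.contDiffAt_implicitFunction hn hinv).congr_of_eventuallyEq h3
  have h5 := (ContinuousMap.evalCLM ℝ (1 : unitInterval) :
    C(unitInterval, E) →L[ℝ] E).contDiff.contDiffAt.comp (t, x) h4
  refine h5.congr_of_eventuallyEq (Filter.Eventually.of_forall fun p => ?_)
  simp [hA]

lemma IsGlobalFlow.contDiff [CompleteSpace E] {a : E → E} {f : ℝ → E → E}
    (hf : IsGlobalFlow a f) (ha : CbSmooth a) :
    ContDiff ℝ (⊤ : ℕ∞) (fun p : ℝ × E => f p.1 p.2) := by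
  obtain ⟨K, hK⟩ := ha.exists_lipschitzWith
  rw [contDiff_iff_contDiffAt]
  rintro ⟨t, x⟩
  obtain ⟨n, hn⟩ := exists_nat_gt (|t| * K)
  have hn0 : (0 : ℝ) < n := lt_of_le_of_lt (by positivity) hn
  have ht : |t / n| * K < 1 := by
    rw [abs_div, Nat.abs_cast, div_mul_eq_mul_div, div_lt_one hn0]
    exact hn
  have key : ∀ k : ℕ, ContDiffAt ℝ (⊤ : ℕ∞) (fun p : ℝ × E => f (k * (p.1 / n)) p.2) (t, x) := by
    intro k
    induction k with
    | zero => simpa [hf.zero_apply] using contDiffAt_snd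
    | succ k ih =>
      have h1 := hf.contDiffAt_of_abs_mul_lt_one ha hK ht (f (k * (t / n)) x)
      have h2 : ContDiffAt ℝ (⊤ : ℕ∞)
          (fun p : ℝ × E => (p.1 / n, f (k * (p.1 / n)) p.2)) (t, x) := by
        have : ContDiffAt ℝ (⊤ : ℕ∞) (fun p : ℝ × E => p.1 / (n : ℝ)) (t, x) := by fun_prop
        exact this.prodMk ih
      refine (ContDiffAt.comp (t, x) h1 h2).congr_of_eventuallyEq
        (Filter.Eventually.of_forall fun p => ?_)
      simp only [Function.comp_apply]
      rw [← hf.add_apply hK]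
      congr 1
      push_cast
      ring
  have := key n
  simpa [mul_div_cancel₀ _ hn0.ne'] using this

end Flow

section Commutator

lemma CbSmooth.vfComm {a b : Ec d → Ec d} (ha : CbSmooth a) (hb : CbSmooth b) :
    CbSmooth (vfComm a b) := by
  have h := (hb.fderiv.clm_apply ha).add ((ha.fderiv.clm_apply hb).const_smul (-1))
  convert h using 2 with x
  simp [_root_.vfComm, sub_eq_add_neg]

lemma two_le_infty : (2 : WithTop ℕ∞) ≤ ((⊤ : ℕ∞) : WithTop ℕ∞) :=
  WithTop.coe_le_coe.2 (le_top : (2 : ℕ∞) ≤ ⊤)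

lemma vfComm_leibniz {a b c : Ec d → Ec d} (ha : CbSmooth a) (hb : CbSmooth b)
    (hc : CbSmooth c) :
    vfComm (vfComm a b) c = vfComm a (vfComm b c) - vfComm b (vfComm a c) := by
  have h2 : minSmoothness ℝ 2 ≤ ((⊤ : ℕ∞) : WithTop ℕ∞) := by
    rw [minSmoothness_of_isRCLikeNormedField]
    exact two_le_infty
  funext x
  have := VectorField.leibniz_identity_lieBracket (𝕜 := ℝ) h2 (x := x)
    ha.1.contDiffAt hb.1.contDiffAt hc.1.contDiffAt
  exact eq_sub_of_add_eq this.symm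

variable {ι : Type*} (Y : ι → Ec d → Ec d)

/-- The span of the iterated commutators of length `j`. -/
def commSpan (j : ℕ) : Submodule ℝ (Ec d → Ec d) :=
  Submodule.span ℝ (Set.range fun v : Fin j → ι => multiComm Y (List.ofFn v))

variable {Y}

lemma multiComm_mem_commSpan (l : List ι) : multiComm Y l ∈ commSpan Y l.length :=
  Submodule.subset_span ⟨l.get, by simp only [List.ofFn_get]⟩

lemma mem_commSpan_one (i : ι) : Y i ∈ commSpan Y 1 :=
  multiComm_mem_commSpan [i]

lemma cbSmooth_multiComm (hY : ∀ i, CbSmooth (Y i)) : ∀ l : List ι, CbSmooth (multiComm Y l)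
  | [] => CbSmooth.zero
  | [i] => hY i
  | i :: j :: l => (hY i).vfComm (cbSmooth_multiComm hY (j :: l))

lemma cbSmooth_of_mem_commSpan (hY : ∀ i, CbSmooth (Y i)) {j : ℕ} {a : Ec d → Ec d}
    (ha : a ∈ commSpan Y j) : CbSmooth a := by
  induction ha using Submodule.span_induction with
  | mem x hx =>
    obtain ⟨v, rfl⟩ := hx
    exact cbSmooth_multiComm hY _
  | zero => exact CbSmooth.zero
  | add x y _ _ hx hy => exact hx.add hy
  | smul c x _ hx => exact hx.const_smul c

lemma vfComm_zero_right (a : Ec d → Ec d) : vfComm a 0 = 0 :=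
  VectorField.lieBracket_zero_right

lemma vfComm_mem_of_forall_right (hY : ∀ i, CbSmooth (Y i)) {j n : ℕ} {a b : Ec d → Ec d}
    (h : ∀ l : List ι, l.length = j → vfComm a (multiComm Y l) ∈ commSpan Y n)
    (hb : b ∈ commSpan Y j) : vfComm a b ∈ commSpan Y n := by
  induction hb using Submodule.span_induction with
  | mem x hx =>
    obtain ⟨v, rfl⟩ := hx
    exact h _ (by simp)
  | zero => rw [vfComm_zero_right]; exact zero_mem _
  | add x y hx hy ihx ihy =>
    have : vfComm a (x + y) = vfComm a x + vfComm a y := funext fun z =>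
      VectorField.lieBracket_add_right
        ((cbSmooth_of_mem_commSpan hY hx).differentiable z)
        ((cbSmooth_of_mem_commSpan hY hy).differentiable z)
    rw [this]
    exact add_mem ihx ihy
  | smul c x hx ihx =>
    have : vfComm a (c • x) = c • vfComm a x := funext fun z =>
      VectorField.lieBracket_const_smul_right
        ((cbSmooth_of_mem_commSpan hY hx).differentiable z)
    rw [this]
    exact Submodule.smul_mem _ _ ihx

lemma vfComm_mem_of_forall_left (hY : ∀ i, CbSmooth (Y i)) {j n : ℕ} {a b : Ec d → Ec d}
    (h : ∀ l : List ι, l.length = j → vfComm (multiComm Y l) b ∈ commSpan Y n)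
    (ha : a ∈ commSpan Y j) : vfComm a b ∈ commSpan Y n := by
  have hswap : ∀ a b : Ec d → Ec d, vfComm a b = -vfComm b a := fun a b =>
    funext fun z => VectorField.lieBracket_swap
  rw [hswap]
  refine neg_mem (vfComm_mem_of_forall_right hY (fun l hl => ?_) ha)
  rw [hswap]
  exact neg_mem (h l hl)

lemma vfComm_mem_commSpan_succ (hY : ∀ i, CbSmooth (Y i)) (i : ι) {j : ℕ} (hj : 1 ≤ j)
    {b : Ec d → Ec d} (hb : b ∈ commSpan Y j) : vfComm (Y i) b ∈ commSpan Y (j + 1) := by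
  refine vfComm_mem_of_forall_right hY (fun l hl => ?_) hb
  match l, hl with
  | [], hl => simp at hl; omega
  | k :: l, hl =>
    have := multiComm_mem_commSpan (Y := Y) (i :: k :: l)
    rw [List.length_cons, hl] at this
    exact this

lemma vfComm_multiComm_mem (hY : ∀ i, CbSmooth (Y i)) : ∀ (l : List ι) {k : ℕ}, l ≠ [] → 1 ≤ k →
    ∀ {b : Ec d → Ec d}, b ∈ commSpan Y k →
      vfComm (multiComm Y l) b ∈ commSpan Y (l.length + k)
  | [], _, h, _, _, _ => absurd rfl h
  | [i], k, _, hk, b, hb => by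
    rw [List.length_singleton, add_comm]
    exact vfComm_mem_commSpan_succ hY i hk hb
  | i :: j :: l, k, _, hk, b, hb => by
    have ih := fun {k : ℕ} => vfComm_multiComm_mem hY (j :: l) (k := k) (by simp)
    have hb' := cbSmooth_of_mem_commSpan hY hb
    change vfComm (vfComm (Y i) (multiComm Y (j :: l))) b ∈ _
    rw [vfComm_leibniz (hY i) (cbSmooth_multiComm hY _) hb']
    have h1 := vfComm_mem_commSpan_succ hY i (by omega) (ih hk hb)
    have h2 := ih (by omega) (vfComm_mem_commSpan_succ hY i hk hb)
    have e1 : (i :: j :: l).length + k = (j :: l).length + k + 1 := by simp; omega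
    rw [e1]
    exact sub_mem h1 (by rwa [← add_assoc] at h2)

lemma vfComm_mem_commSpan (hY : ∀ i, CbSmooth (Y i)) {j k : ℕ} (hj : 1 ≤ j) (hk : 1 ≤ k)
    {a b : Ec d → Ec d} (ha : a ∈ commSpan Y j) (hb : b ∈ commSpan Y k) :
    vfComm a b ∈ commSpan Y (j + k) := by
  refine vfComm_mem_of_forall_left hY (fun l hl => ?_) ha
  have := vfComm_multiComm_mem hY l (by rintro rfl; simp at hl; omega) hk hb
  rwa [hl] at this

lemma iterate_vfComm_mem_commSpan (hY : ∀ i, CbSmooth (Y i)) {m k : ℕ} (hm : 1 ≤ m) (hk : 1 ≤ k)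
    {a b : Ec d → Ec d} (ha : a ∈ commSpan Y m) (hb : b ∈ commSpan Y k) (i : ℕ) :
    (vfComm a)^[i] b ∈ commSpan Y (k + m * i) := by
  induction i with
  | zero => simpa using hb
  | succ i ih =>
    rw [Function.iterate_succ_apply']
    have := vfComm_mem_commSpan hY hm (by omega) ha ih
    rwa [show m + (k + m * i) = k + m * (i + 1) by ring] at this

end Commutator

section Pushforward

lemma IsFlowOf.isGlobalFlow {a : Ec d → Ec d} {f : ℝ → Ec d → Ec d} (hf : IsFlowOf a f) :
    IsGlobalFlow a f :=
  ⟨hf.2.1, hf.2.2⟩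

lemma exists_isFlowOf {a : Ec d → Ec d} (ha : CbSmooth a) : ∃ f, IsFlowOf a f := by
  obtain ⟨f, hf⟩ := exists_isGlobalFlow ha
  exact ⟨f, hf.contDiff ha, hf.zero_apply, hf.hasDerivAt⟩

section Partial

variable {E F : Type*} [NormedAddCommGroup E] [NormedSpace ℝ E] [NormedAddCommGroup F]
  [NormedSpace ℝ F] {f : ℝ → E → F}

lemma fderiv_section_eq (hf : ContDiff ℝ (⊤ : ℕ∞) fun p : ℝ × E => f p.1 p.2) (t : ℝ) (x : E) :
    fderiv ℝ (f t) x = fderiv ℝ (fun p : ℝ × E => f p.1 p.2) (t, x) ∘L .inr ℝ ℝ E :=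
  (HasFDerivAt.comp x ((hf.differentiable (by simp)) (t, x)).hasFDerivAt
    (hasFDerivAt_prodMk_right t x)).fderiv

lemma differentiable_section (hf : ContDiff ℝ (⊤ : ℕ∞) fun p : ℝ × E => f p.1 p.2) (t : ℝ) :
    Differentiable ℝ (f t) :=
  (hf.differentiable (by simp)).comp (by fun_prop : Differentiable ℝ fun x : E => (t, x))

lemma contDiff_fderiv_section (hf : ContDiff ℝ (⊤ : ℕ∞) fun p : ℝ × E => f p.1 p.2) :
    ContDiff ℝ (⊤ : ℕ∞) fun p : ℝ × E => fderiv ℝ (f p.1) p.2 := by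
  simp only [fderiv_section_eq hf]
  have : ContDiff ℝ (⊤ : ℕ∞) (fderiv ℝ (fun p : ℝ × E => f p.1 p.2)) :=
    hf.fderiv_right (by simp)
  exact this.clm_comp contDiff_const

end Partial

variable {a : Ec d → Ec d} {f : ℝ → Ec d → Ec d}

/-- The variational equation of a flow. -/
lemma IsFlowOf.hasDerivAt_fderiv (hf : IsFlowOf a f) (ha : CbSmooth a) (t : ℝ) (x : Ec d) :
    HasDerivAt (fun s => fderiv ℝ (f s) x) (fderiv ℝ a (f t x) ∘L fderiv ℝ (f t) x) t := by
  set F : ℝ × Ec d → Ec d := fun p => f p.1 p.2 with hF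
  have hFd : Differentiable ℝ F := hf.1.differentiable (by simp)
  have hF' : ContDiff ℝ (⊤ : ℕ∞) (fderiv ℝ F) := hf.1.fderiv_right (by simp)
  have hF'd := (hF'.differentiable (by simp)) (t, x)
  have h1 : HasDerivAt (fun s => fderiv ℝ F (s, x)) (fderiv ℝ (fderiv ℝ F) (t, x) (1, 0)) t :=
    hF'd.hasFDerivAt.comp_hasDerivAt t ((hasDerivAt_id t).prodMk (hasDerivAt_const t x))
  have h2 : HasDerivAt (fun s => fderiv ℝ (f s) x)
      (fderiv ℝ (fderiv ℝ F) (t, x) (1, 0) ∘L .inr ℝ ℝ (Ec d)) t := by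
    simp only [fderiv_section_eq hf.1]
    simpa using h1.clm_comp (hasDerivAt_const t (ContinuousLinearMap.inr ℝ ℝ (Ec d)))
  convert h2 using 1
  ext1 v
  have hsymm : IsSymmSndFDerivAt ℝ F (t, x) := hf.1.contDiffAt.isSymmSndFDerivAt (by
    rw [minSmoothness_of_isRCLikeNormedField]
    exact two_le_infty)
  have h3 : ∀ y, fderiv ℝ F (t, y) (1, 0) = a (f t y) := fun y => by
    have : HasDerivAt (F ∘ fun s : ℝ => (s, y)) (fderiv ℝ F (t, y) (1, 0)) t :=
      (hFd (t, y)).hasFDerivAt.comp_hasDerivAt t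
        ((hasDerivAt_id t).prodMk (hasDerivAt_const t y))
    exact this.unique (hf.2.2 t y)
  have h4 : HasFDerivAt (fun y => fderiv ℝ F (t, y) (1, 0))
      ((fderiv ℝ (fderiv ℝ F) (t, x) ∘L .inr ℝ ℝ (Ec d)).flip (1, 0)) x := by
    have := (HasFDerivAt.comp x hF'd.hasFDerivAt (hasFDerivAt_prodMk_right t x)).clm_apply
      (hasFDerivAt_const ((1, 0) : ℝ × Ec d) x)
    simpa using this
  have h5 : HasFDerivAt (fun y => a (f t y)) (fderiv ℝ a (f t x) ∘L fderiv ℝ (f t) x) x :=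
    (ha.differentiable _).hasFDerivAt.comp x (differentiable_section hf.1 t x).hasFDerivAt
  simp only [h3] at h4
  have h6 := congrArg (fun L => L v) (h5.unique h4)
  simp only [ContinuousLinearMap.flip_apply, ContinuousLinearMap.comp_apply] at h6 ⊢
  rw [h6, hsymm]

lemma IsFlowOf.reverse (hf : IsFlowOf a f) : IsFlowOf (fun x => -a x) (fun t => f (-t)) :=
  ⟨hf.1.comp (f := fun p : ℝ × Ec d => (-p.1, p.2)) (by fun_prop),
    hf.isGlobalFlow.reverse.zero_apply, hf.isGlobalFlow.reverse.hasDerivAt⟩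

lemma IsFlowOf.fderiv_neg_comp_fderiv (hf : IsFlowOf a f) {K : NNReal} (hK : LipschitzWith K a)
    (t : ℝ) (x : Ec d) :
    fderiv ℝ (f (-t)) (f t x) ∘L fderiv ℝ (f t) x = ContinuousLinearMap.id ℝ (Ec d) := by
  have h := (differentiable_section hf.1 (-t) (f t x)).hasFDerivAt.comp x
    (differentiable_section hf.1 t x).hasFDerivAt
  refine h.unique ((hasFDerivAt_id x).congr_of_eventuallyEq (Filter.Eventually.of_forall fun y => ?_))
  exact hf.isGlobalFlow.neg_apply_apply hK t y

/-- The pushforward of the vector field `w` under the flow `f` at time `s`. -/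
def flowPush (f : ℝ → Ec d → Ec d) (s : ℝ) (w : Ec d → Ec d) (y : Ec d) : Ec d :=
  fderiv ℝ (f s) (f (-s) y) (w (f (-s) y))

lemma IsFlowOf.hasDerivAt_fderiv_comp_neg (hf : IsFlowOf a f) (ha : CbSmooth a) (s : ℝ)
    (y : Ec d) :
    HasDerivAt (fun s => fderiv ℝ (f s) (f (-s) y))
      (fderiv ℝ (f s) (f (-s) y) ∘L fderiv ℝ a (f (-s) y)) s := by
  obtain ⟨K, hK⟩ := ha.exists_lipschitzWith
  set P := fun s => fderiv ℝ (f s) (f (-s) y) with hP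
  set J := fun s => fderiv ℝ (f (-s)) y with hJ
  have hPJ : ∀ s, P s ∘L J s = ContinuousLinearMap.id ℝ (Ec d) := fun s => by
    simpa using hf.fderiv_neg_comp_fderiv hK (-s) y
  have hJP : ∀ s, J s ∘L P s = ContinuousLinearMap.id ℝ (Ec d) := fun s => by
    have := hf.fderiv_neg_comp_fderiv hK s (f (-s) y)
    rwa [show f s (f (-s) y) = y by
      simpa using hf.isGlobalFlow.neg_apply_apply hK (-s) y] at this
  have hPd : DifferentiableAt ℝ P s := by
    have h1 : ContDiff ℝ (⊤ : ℕ∞) fun s : ℝ => (s, f (-s) y) :=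
      contDiff_id.prodMk (hf.1.comp (f := fun s : ℝ => (-s, y)) (by fun_prop))
    exact (((contDiff_fderiv_section hf.1).comp h1).differentiable (by simp)) s
  have hJd : HasDerivAt J (-(fderiv ℝ a (f (-s) y) ∘L J s)) s := by
    have := (hf.hasDerivAt_fderiv ha (-s) y).scomp s (hasDerivAt_neg s)
    simpa [Function.comp_def] using this
  have h1 := hPd.hasDerivAt.clm_comp hJd
  simp only [hPJ] at h1
  have h2 := h1.unique (hasDerivAt_const s (ContinuousLinearMap.id ℝ (Ec d)))
  have h3 : deriv P s = P s ∘L fderiv ℝ a (f (-s) y) := by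
    have h4 : deriv P s ∘L J s = P s ∘L (fderiv ℝ a (f (-s) y) ∘L J s) := by
      rw [← sub_eq_zero, ← h2, ContinuousLinearMap.comp_neg, sub_eq_add_neg]
    calc deriv P s = (deriv P s ∘L J s) ∘L P s := by
          rw [ContinuousLinearMap.comp_assoc, hJP, ContinuousLinearMap.comp_id]
      _ = (P s ∘L fderiv ℝ a (f (-s) y)) ∘L (J s ∘L P s) := by
          rw [h4]; rfl
      _ = _ := by rw [hJP, ContinuousLinearMap.comp_id]
  rw [← h3]
  exact hPd.hasDerivAt

lemma IsFlowOf.hasDerivAt_flowPush (hf : IsFlowOf a f) (ha : CbSmooth a) {w : Ec d → Ec d}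
    (hw : CbSmooth w) (s : ℝ) (y : Ec d) :
    HasDerivAt (fun s => flowPush f s w y) (-flowPush f s (vfComm a w) y) s := by
  have h1 : HasDerivAt (fun s => w (f (-s) y)) (fderiv ℝ w (f (-s) y) (-a (f (-s) y))) s :=
    (hw.differentiable _).hasFDerivAt.comp_hasDerivAt s (hf.reverse.2.2 s y)
  refine HasDerivAt.congr_deriv ((hf.hasDerivAt_fderiv_comp_neg ha s y).clm_apply h1) ?_
  simp [flowPush, vfComm, sub_eq_add_neg]

lemma IsFlowOf.exists_norm_flowPush_le (hf : IsFlowOf a f) (ha : CbSmooth a) :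
    ∃ B : ℝ, 0 ≤ B ∧ ∀ s, |s| ≤ 1 → ∀ (w : Ec d → Ec d) (C : ℝ), (∀ x, ‖w x‖ ≤ C) →
      ∀ y, ‖flowPush f s w y‖ ≤ B * C := by
  obtain ⟨K, hK⟩ := ha.exists_lipschitzWith
  refine ⟨Real.exp K, (Real.exp_pos _).le, fun s hs w C hw y => ?_⟩
  have h1 : LipschitzWith ⟨Real.exp (K * |s|), (Real.exp_pos _).le⟩ (f s) :=
    LipschitzWith.of_dist_le_mul fun x y => by
      rw [mul_comm]
      exact hf.isGlobalFlow.dist_le hK s x y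
  have h2 : ‖fderiv ℝ (f s) (f (-s) y)‖ ≤ Real.exp K := by
    refine (norm_fderiv_le_of_lipschitz ℝ h1).trans ?_
    change Real.exp (K * |s|) ≤ _
    exact Real.exp_le_exp.2 (mul_le_of_le_one_right K.2 hs)
  exact ContinuousLinearMap.le_of_opNorm_le_of_le _ h2 (hw _)

/-- Taylor expansion of the pushforward of a vector field under a flow. -/
lemma IsFlowOf.exists_norm_flowPush_sub_le (hf : IsFlowOf a f) (ha : CbSmooth a) (M : ℕ) :
    ∀ {w : Ec d → Ec d}, CbSmooth w → ∃ C : ℝ, 0 ≤ C ∧ ∀ s, |s| ≤ 1 → ∀ y,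
      ‖flowPush f s w y - ∑ i ∈ Finset.range M,
        ((-s) ^ i / (i.factorial : ℝ)) • (vfComm a)^[i] w y‖ ≤ C * |s| ^ M := by
  induction M with
  | zero =>
    intro w hw
    obtain ⟨B, hB0, hB⟩ := hf.exists_norm_flowPush_le ha
    obtain ⟨C, hC0, hC⟩ := hw.exists_norm_le
    exact ⟨B * C, by positivity, fun s hs y => by simpa using hB s hs w C hC y⟩
  | succ M ih =>
    intro w hw
    obtain ⟨C, hC0, hC⟩ := ih (ha.vfComm hw)
    refine ⟨C, hC0, fun s hs y => ?_⟩
    set R : ℝ → Ec d := fun s => flowPush f s w y - ∑ i ∈ Finset.range (M + 1),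
        ((-s) ^ i / (i.factorial : ℝ)) • (vfComm a)^[i] w y with hR
    have hder : ∀ r, HasDerivAt R (-(flowPush f r (vfComm a w) y - ∑ i ∈ Finset.range M,
        ((-r) ^ i / (i.factorial : ℝ)) • (vfComm a)^[i] (vfComm a w) y)) r := by
      intro r
      have h1 : HasDerivAt (fun s : ℝ => ∑ i ∈ Finset.range (M + 1),
          ((-s) ^ i / (i.factorial : ℝ)) • (vfComm a)^[i] w y)
          (-∑ i ∈ Finset.range M,
            ((-r) ^ i / (i.factorial : ℝ)) • (vfComm a)^[i] (vfComm a w) y) r := by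
        simp only [Finset.sum_range_succ', pow_zero]
        rw [← Finset.sum_neg_distrib]
        have h2 : ∀ i ∈ Finset.range M, HasDerivAt (fun s : ℝ =>
            ((-s) ^ (i + 1) / ((i + 1).factorial : ℝ)) • (vfComm a)^[i + 1] w y)
            (-(((-r) ^ i / (i.factorial : ℝ)) • (vfComm a)^[i] (vfComm a w) y)) r := by
          intro i _
          have h3 := (((hasDerivAt_neg r).fun_pow (i + 1)).div_const
            ((i + 1).factorial : ℝ)).smul_const ((vfComm a)^[i + 1] w y)
          rw [Function.iterate_succ_apply] at h3
          refine HasDerivAt.congr_deriv h3 ?_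
          rw [← neg_smul]
          congr 1
          rw [Nat.factorial_succ]
          have := Nat.cast_add_one_ne_zero (R := ℝ) i
          have := Nat.cast_ne_zero (R := ℝ).2 i.factorial_ne_zero
          push_cast
          field_simp
        exact (HasDerivAt.fun_sum h2).add_const _
      refine HasDerivAt.congr_deriv ((hf.hasDerivAt_flowPush ha hw r y).sub h1) ?_
      abel
    have hR0 : R 0 = 0 := by
      have h0 : flowPush f 0 w y = w y := by
        have : f 0 = id := funext hf.2.1
        simp [flowPush, this]
      simp [hR, Finset.sum_range_succ', h0]
    have hmv := (convex_Icc (-|s|) |s|).norm_image_sub_le_of_norm_hasDerivWithin_le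
      (f := R) (x := 0) (y := s) (C := C * |s| ^ M)
      (fun r _ => (hder r).hasDerivWithinAt) (fun r hr => ?_)
      ⟨by simp, by simp⟩ ⟨neg_abs_le s, le_abs_self s⟩
    · rw [hR0, sub_zero, sub_zero, Real.norm_eq_abs, mul_assoc, ← pow_succ] at hmv
      exact hmv
    · have hr' : |r| ≤ |s| := abs_le.2 hr
      rw [norm_neg]
      refine (hC r (hr'.trans hs) y).trans ?_
      gcongr

end Pushforward

section Expansion

variable {ι : Type*} {Y : ι → Ec d → Ec d} {N : ℕ}

/-- `W t = ∑_{k < N} t ^ k w_k + O(|t| ^ N)` uniformly on `ℝ^d` for `|t| ≤ 1`, where each `w_k` is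
a linear combination of iterated commutators of length `k + 1`. -/
structure HasExpansion (Y : ι → Ec d → Ec d) (N : ℕ) (W : ℝ → Ec d → Ec d)
    (w : ℕ → Ec d → Ec d) : Prop where
  mem : ∀ k, w k ∈ commSpan Y (k + 1)
  bound : ∃ C : ℝ, 0 ≤ C ∧ ∀ t, |t| ≤ 1 → ∀ x,
    ‖W t x - ∑ k ∈ Finset.range N, t ^ k • w k x‖ ≤ C * |t| ^ N

namespace HasExpansion

lemma add {W W' : ℝ → Ec d → Ec d} {w w' : ℕ → Ec d → Ec d} (h : HasExpansion Y N W w)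
    (h' : HasExpansion Y N W' w') :
    HasExpansion Y N (fun t x => W t x + W' t x) (w + w') := by
  refine ⟨fun k => add_mem (h.mem k) (h'.mem k), ?_⟩
  obtain ⟨C, hC0, hC⟩ := h.bound
  obtain ⟨C', hC0', hC'⟩ := h'.bound
  refine ⟨C + C', by positivity, fun t ht x => ?_⟩
  have e : W t x + W' t x - ∑ k ∈ Finset.range N, t ^ k • (w + w') k x =
      (W t x - ∑ k ∈ Finset.range N, t ^ k • w k x) +
        (W' t x - ∑ k ∈ Finset.range N, t ^ k • w' k x) := by
    simp only [Pi.add_apply, smul_add, Finset.sum_add_distrib]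
    abel
  rw [e, add_mul]
  exact (norm_add_le _ _).trans (add_le_add (hC t ht x) (hC' t ht x))

lemma of_bound {W : ℝ → Ec d → Ec d} {C : ℝ} (hC0 : 0 ≤ C)
    (hC : ∀ t, |t| ≤ 1 → ∀ x, ‖W t x‖ ≤ C * |t| ^ N) : HasExpansion Y N W 0 :=
  ⟨fun _ => zero_mem _, C, hC0, fun t ht x => by simpa using hC t ht x⟩

lemma sum {κ : Type*} (s : Finset κ) {W : κ → ℝ → Ec d → Ec d} {w : κ → ℕ → Ec d → Ec d}
    (h : ∀ i ∈ s, HasExpansion Y N (W i) (w i)) :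
    HasExpansion Y N (fun t x => ∑ i ∈ s, W i t x) (∑ i ∈ s, w i) := by
  classical
  induction s using Finset.induction_on with
  | empty => exact of_bound le_rfl fun t _ x => by simp
  | insert i s hi ih =>
    simp only [Finset.sum_insert hi]
    exact (h i (Finset.mem_insert_self i s)).add
      (ih fun j hj => h j (Finset.mem_insert_of_mem hj))

lemma monomial (hY : ∀ i, CbSmooth (Y i)) {j : ℕ} {u : Ec d → Ec d}
    (hu : u ∈ commSpan Y (j + 1)) :
    HasExpansion Y N (fun t x => t ^ j • u x) (Pi.single j u) := by
  refine ⟨fun k => ?_, ?_⟩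
  · by_cases hk : k = j
    · subst hk
      rwa [Pi.single_eq_same]
    · rw [Pi.single_eq_of_ne hk]
      exact zero_mem _
  · obtain ⟨C, hC0, hC⟩ := (cbSmooth_of_mem_commSpan hY hu).exists_norm_le
    refine ⟨C, hC0, fun t ht x => ?_⟩
    have hz : ∀ k, k ≠ j → t ^ k • (Pi.single j u : ℕ → Ec d → Ec d) k x = 0 := fun k hk => by
      rw [Pi.single_eq_of_ne hk, Pi.zero_apply, smul_zero]
    by_cases hj : j < N
    · rw [Finset.sum_eq_single_of_mem j (Finset.mem_range.2 hj) fun k _ hk => hz k hk,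
        Pi.single_eq_same, sub_self, norm_zero]
      positivity
    · rw [Finset.sum_eq_zero fun k hk => hz k (by have := Finset.mem_range.1 hk; omega), sub_zero,
        norm_smul, norm_pow, Real.norm_eq_abs, mul_comm]
      exact mul_le_mul (hC x) (pow_le_pow_of_le_one (abs_nonneg t) ht (not_lt.1 hj))
        (by positivity) hC0

end HasExpansion

lemma abs_mul_pow_le {c t : ℝ} (hc : |c| ≤ 1) (ht : |t| ≤ 1) {m : ℕ} (hm : 1 ≤ m) :
    |c * t ^ m| ≤ |t| := by
  rw [abs_mul, abs_pow]
  calc |c| * |t| ^ m ≤ 1 * |t| ^ 1 :=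
        mul_le_mul hc (pow_le_pow_of_le_one (abs_nonneg t) ht hm) (by positivity) zero_le_one
    _ = |t| := by ring

variable {X : Ec d → Ec d} {f : ℝ → Ec d → Ec d} {m : ℕ} {c : ℝ}

lemma HasExpansion.flowPush_monomial (hY : ∀ i, CbSmooth (Y i)) (hX : X ∈ commSpan Y m)
    (hm : 1 ≤ m) (hf : IsFlowOf X f) (hc : |c| ≤ 1) {k : ℕ} {u : Ec d → Ec d}
    (hu : u ∈ commSpan Y (k + 1)) :
    HasExpansion Y N (fun t y => t ^ k • flowPush f (c * t ^ m) u y)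
      (∑ i ∈ Finset.range N, Pi.single (k + m * i)
        (((-c) ^ i / (i.factorial : ℝ)) • (vfComm X)^[i] u)) := by
  have hXs := cbSmooth_of_mem_commSpan hY hX
  obtain ⟨C, hC0, hC⟩ := hf.exists_norm_flowPush_sub_le hXs N (cbSmooth_of_mem_commSpan hY hu)
  have h1 : HasExpansion Y N (fun t y => t ^ k • (flowPush f (c * t ^ m) u y -
      ∑ i ∈ Finset.range N, ((-(c * t ^ m)) ^ i / (i.factorial : ℝ)) • (vfComm X)^[i] u y)) 0 := by
    refine .of_bound hC0 fun t ht x => ?_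
    have hct := abs_mul_pow_le hc ht hm
    rw [norm_smul, norm_pow, Real.norm_eq_abs]
    calc _ ≤ 1 * (C * |c * t ^ m| ^ N) := by
          gcongr
          · exact pow_le_one₀ (abs_nonneg t) ht
          · exact hC _ (hct.trans ht) x
      _ ≤ _ := by
          rw [one_mul]
          gcongr
  have h2 : HasExpansion Y N (fun t y => ∑ i ∈ Finset.range N, t ^ (k + m * i) •
      (((-c) ^ i / (i.factorial : ℝ)) • (vfComm X)^[i] u) y) _ :=
    .sum _ fun i _ => .monomial hY (Submodule.smul_mem _ _ (by
      have := iterate_vfComm_mem_commSpan hY hm (by omega) hX hu i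
      rwa [add_right_comm] at this))
  have h3 := h1.add h2
  rw [zero_add] at h3
  convert h3 using 3 with t y
  rw [smul_sub, Finset.smul_sum, ← sub_eq_iff_eq_add', sub_sub_cancel]
  refine Finset.sum_congr rfl fun i _ => ?_
  rw [Pi.smul_apply, smul_smul, smul_smul]
  congr 1
  ring

lemma HasExpansion.exists_flowPush (hY : ∀ i, CbSmooth (Y i)) (hX : X ∈ commSpan Y m)
    (hm : 1 ≤ m) (hf : IsFlowOf X f) (hc : |c| ≤ 1) {W : ℝ → Ec d → Ec d} {w : ℕ → Ec d → Ec d}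
    (h : HasExpansion Y N W w) {n : ℕ} (hn : n < N) (hw : ∀ k < n, w k = 0) :
    ∃ w', HasExpansion Y N (fun t y => flowPush f (c * t ^ m) (W t) y) w' ∧
      ∀ k ≤ n, w' k = w k := by
  obtain ⟨B, hB0, hB⟩ := hf.exists_norm_flowPush_le (cbSmooth_of_mem_commSpan hY hX)
  obtain ⟨C, hC0, hC⟩ := h.bound
  have h1 : HasExpansion Y N (fun t y => flowPush f (c * t ^ m)
      (fun x => W t x - ∑ k ∈ Finset.range N, t ^ k • w k x) y) 0 :=
    .of_bound (C := B * C) (by positivity) fun t ht x => by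
      rw [mul_assoc]
      exact hB _ ((abs_mul_pow_le hc ht hm).trans ht) _ _ (hC t ht) x
  have h2 := HasExpansion.sum (Finset.range N) fun k _ =>
    HasExpansion.flowPush_monomial (N := N) hY hX hm hf hc (h.mem k)
  have h3 := h1.add h2
  rw [zero_add] at h3
  refine ⟨∑ k ∈ Finset.range N, ∑ i ∈ Finset.range N, Pi.single (k + m * i)
    (((-c) ^ i / (i.factorial : ℝ)) • (vfComm X)^[i] (w k)), ?_, fun k hk => ?_⟩
  · convert h3 using 3 with t y
    simp only [flowPush, map_sub, map_sum, map_smul]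
    abel
  · simp only [Finset.sum_apply]
    rw [Finset.sum_eq_single_of_mem k (Finset.mem_range.2 (by omega)),
      Finset.sum_eq_single_of_mem 0 (Finset.mem_range.2 (by omega))]
    · simp
    · intro i _ hi
      refine Pi.single_eq_of_ne ?_ _
      have := Nat.mul_pos hm (Nat.pos_of_ne_zero hi)
      omega
    · intro j _ hj
      refine Finset.sum_eq_zero fun i _ => ?_
      rcases lt_or_gt_of_ne hj with hjk | hjk
      · have : (vfComm X)^[i] 0 = 0 := Function.iterate_fixed (vfComm_zero_right X) i
        rw [hw j (by omega), this, smul_zero, Pi.single_zero, Pi.zero_apply]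
      · exact Pi.single_eq_of_ne (by omega) _

/-- The family of maps `Φ t`, equal to the identity at `t = 0`, transports vector fields having a
commutator expansion into vector fields having an expansion with the same leading term. -/
structure Transports (Y : ι → Ec d → Ec d) (N : ℕ) (Φ : ℝ → Ec d → Ec d) : Prop where
  contDiff : ContDiff ℝ (⊤ : ℕ∞) fun p : ℝ × Ec d => Φ p.1 p.2
  zero_apply : ∀ x, Φ 0 x = x
  exists_transport : ∀ {W : ℝ → Ec d → Ec d} {w : ℕ → Ec d → Ec d} {n : ℕ}, n < N →
    HasExpansion Y N W w → (∀ k < n, w k = 0) → ∃ W' w', HasExpansion Y N W' w' ∧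
      (∀ k ≤ n, w' k = w k) ∧ ∀ t x, W' t (Φ t x) = fderiv ℝ (Φ t) x (W t x)

lemma Transports.id : Transports Y N fun _ x => x :=
  ⟨contDiff_snd, fun _ => rfl, fun {W w _} _ h _ => ⟨W, w, h, fun _ _ => rfl, fun t x => by simp⟩⟩

lemma IsFlowOf.transports (hY : ∀ i, CbSmooth (Y i)) (hX : X ∈ commSpan Y m) (hm : 1 ≤ m)
    (hf : IsFlowOf X f) (hc : |c| ≤ 1) : Transports Y N fun t => f (c * t ^ m) := by
  refine ⟨hf.1.comp (f := fun p : ℝ × Ec d => (c * p.1 ^ m, p.2)) (by fun_prop), fun x => ?_,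
    fun {W w n} hn h hw => ?_⟩
  · rw [zero_pow (by omega), mul_zero, hf.2.1]
  · obtain ⟨K, hK⟩ := (cbSmooth_of_mem_commSpan hY hX).exists_lipschitzWith
    obtain ⟨w', h1, h2⟩ := h.exists_flowPush hY hX hm hf hc hn hw
    refine ⟨_, w', h1, h2, fun t x => ?_⟩
    rw [flowPush, hf.isGlobalFlow.neg_apply_apply hK]

lemma Transports.comp {Φ Ψ : ℝ → Ec d → Ec d} (hΦ : Transports Y N Φ) (hΨ : Transports Y N Ψ) :
    Transports Y N fun t x => Φ t (Ψ t x) := by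
  refine ⟨hΦ.contDiff.comp (contDiff_fst.prodMk hΨ.contDiff), fun x => ?_,
    fun {W w n} hn h hw => ?_⟩
  · rw [hΨ.zero_apply, hΦ.zero_apply]
  · obtain ⟨W₁, w₁, h₁, hw₁, hW₁⟩ := hΨ.exists_transport hn h hw
    obtain ⟨W₂, w₂, h₂, hw₂, hW₂⟩ := hΦ.exists_transport hn h₁ fun k hk => by
      rw [hw₁ k hk.le, hw k hk]
    refine ⟨W₂, w₂, h₂, fun k hk => (hw₂ k hk).trans (hw₁ k hk), fun t x => ?_⟩
    have := ((differentiable_section hΦ.contDiff t (Ψ t x)).hasFDerivAt.comp x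
      (differentiable_section hΨ.contDiff t x).hasFDerivAt).fderiv
    change _ = fderiv ℝ (Φ t ∘ Ψ t) x (W t x)
    rw [this, hW₂, hW₁]
    rfl

/-- The curves `t ↦ Φ t x` are driven by a time-dependent vector field with expansion `v`. -/
structure IsGeneratedBy (Y : ι → Ec d → Ec d) (N : ℕ) (Φ : ℝ → Ec d → Ec d)
    (v : ℕ → Ec d → Ec d) : Prop extends Transports Y N Φ where
  exists_generator : ∃ V, HasExpansion Y N V v ∧
    ∀ t x, HasDerivAt (fun s => Φ s x) (V t (Φ t x)) t

lemma IsGeneratedBy.id : IsGeneratedBy Y N (fun _ x => x) 0 :=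
  ⟨.id, fun _ _ => 0, .of_bound le_rfl fun t _ x => by simp, fun t x => hasDerivAt_const t x⟩

lemma IsGeneratedBy.comp_flow (hY : ∀ i, CbSmooth (Y i)) {Φ : ℝ → Ec d → Ec d}
    {v : ℕ → Ec d → Ec d} (hΦ : IsGeneratedBy Y N Φ v) (hX : X ∈ commSpan Y m) (hm : 1 ≤ m)
    (hmN : m ≤ N) (hf : IsFlowOf X f) (hc : |c| ≤ 1) :
    ∃ v', IsGeneratedBy Y N (fun t x => Φ t (f (c * t ^ m) x)) v' ∧
      ∀ k < m, v' k = v k + (Pi.single (m - 1) ((c * m) • X) : ℕ → Ec d → Ec d) k := by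
  obtain ⟨V, hV, hΦV⟩ := hΦ.exists_generator
  have hW : HasExpansion Y N (fun t x => t ^ (m - 1) • ((c * m) • X) x)
      (Pi.single (m - 1) ((c * m) • X)) :=
    .monomial hY (by rw [Nat.sub_add_cancel hm]; exact Submodule.smul_mem _ _ hX)
  obtain ⟨W', w', hW', hw', hWW'⟩ := hΦ.exists_transport (by omega : m - 1 < N) hW
    fun k hk => Pi.single_eq_of_ne hk.ne _
  refine ⟨v + w', ⟨hΦ.toTransports.comp (hf.transports hY hX hm hc), _, hV.add hW',
    fun t x => ?_⟩, fun k hk => ?_⟩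
  · set y := f (c * t ^ m) x with hy
    have hFd := (hΦ.contDiff.differentiable (by simp) (t, y)).hasFDerivAt
    have h1 : HasDerivAt (fun s => c * s ^ m) (c * (m * t ^ (m - 1))) t :=
      (hasDerivAt_pow m t).const_mul c
    have h2 : HasDerivAt ((fun r => f r x) ∘ fun s => c * s ^ m) ((c * (m * t ^ (m - 1))) • X y) t :=
      (hf.2.2 (c * t ^ m) x).scomp t h1
    have h3 : HasDerivAt ((fun p : ℝ × Ec d => Φ p.1 p.2) ∘ fun s => (s, f (c * s ^ m) x))
        (fderiv ℝ (fun p : ℝ × Ec d => Φ p.1 p.2) (t, y) (1, (c * (m * t ^ (m - 1))) • X y)) t :=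
      hFd.comp_hasDerivAt t ((hasDerivAt_id t).prodMk h2)
    have h4 : HasDerivAt ((fun p : ℝ × Ec d => Φ p.1 p.2) ∘ fun s => (s, y))
        (fderiv ℝ (fun p : ℝ × Ec d => Φ p.1 p.2) (t, y) (1, 0)) t :=
      hFd.comp_hasDerivAt t ((hasDerivAt_id t).prodMk (hasDerivAt_const t y))
    have h5 := h4.unique (hΦV t y)
    refine HasDerivAt.congr_deriv h3 ?_
    rw [hWW', ← h5, fderiv_section_eq hΦ.contDiff, ContinuousLinearMap.comp_apply,
      ContinuousLinearMap.inr_apply, ← map_add, Prod.mk_add_mk, add_zero, zero_add,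
      Pi.smul_apply, smul_smul]
    ring_nf
  · rw [Pi.add_apply, hw' k (by omega)]

lemma IsGeneratedBy.exists_norm_sub_le {Φ : ℝ → Ec d → Ec d} {v : ℕ → Ec d → Ec d}
    (hΦ : IsGeneratedBy Y N Φ v) (hv : ∀ k < N, v k = 0) :
    ∃ C : ℝ, 0 ≤ C ∧ ∀ t, |t| ≤ 1 → ∀ x, ‖Φ t x - x‖ ≤ C * |t| ^ (N + 1) := by
  obtain ⟨V, hV, hΦV⟩ := hΦ.exists_generator
  obtain ⟨C, hC0, hC⟩ := hV.bound
  refine ⟨C, hC0, fun t ht x => ?_⟩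
  have hmv := (convex_Icc (-|t|) |t|).norm_image_sub_le_of_norm_hasDerivWithin_le
    (f := fun s => Φ s x) (x := 0) (y := t) (C := C * |t| ^ N)
    (fun r _ => (hΦV r x).hasDerivWithinAt) (fun r hr => ?_)
    ⟨by simp, by simp⟩ ⟨neg_abs_le t, le_abs_self t⟩
  · rwa [hΦ.zero_apply, sub_zero, Real.norm_eq_abs, mul_assoc, ← pow_succ] at hmv
  · have hr' : |r| ≤ |t| := abs_le.2 hr
    have := hC r (hr'.trans ht) (Φ r x)
    rw [Finset.sum_eq_zero fun k hk => by
      rw [hv k (Finset.mem_range.1 hk), Pi.zero_apply, smul_zero], sub_zero] at this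
    refine this.trans ?_
    gcongr

/-- Leading terms of the generator can be cancelled successively by composing with flows of
commutators of increasing length. -/
lemma IsGeneratedBy.exists_foldr (hY : ∀ i, CbSmooth (Y i)) {Φ : ℝ → Ec d → Ec d}
    {v : ℕ → Ec d → Ec d} (hΦ : IsGeneratedBy Y N Φ v) (hv : v 0 = 0) (p : ℕ) (hp : p + 1 ≤ N) :
    ∃ (Z : ℕ → Ec d → Ec d) (g : ℕ → ℝ → Ec d → Ec d),
      (∀ j, 2 ≤ j → j ≤ p + 1 → Z j ∈ commSpan Y j ∧ IsFlowOf (Z j) (g j)) ∧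
      ∃ v', IsGeneratedBy Y N
        (fun t x => Φ t ((List.range' 2 p).foldr (fun j y => g j (-(t ^ j)) y) x)) v' ∧
        ∀ k < p + 1, v' k = 0 := by
  induction p with
  | zero =>
    refine ⟨0, 0, fun j h1 h2 => by omega, v, hΦ, fun k hk => ?_⟩
    rwa [Nat.lt_one_iff.1 hk]
  | succ p ih =>
    obtain ⟨Z, g, hZ, v', hv', hv0⟩ := ih (by omega)
    obtain ⟨V, hV, -⟩ := hv'.exists_generator
    set X : Ec d → Ec d := ((p + 2 : ℕ) : ℝ)⁻¹ • v' (p + 1) with hXdef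
    have hX : X ∈ commSpan Y (p + 2) := Submodule.smul_mem _ _ (hV.mem (p + 1))
    obtain ⟨f, hf⟩ := exists_isFlowOf (cbSmooth_of_mem_commSpan hY hX)
    obtain ⟨v'', hv'', hadd⟩ := hv'.comp_flow hY hX (by omega) hp hf (c := -1) (by simp)
    refine ⟨Function.update Z (p + 2) X, Function.update g (p + 2) f, fun j h1 h2 => ?_, v'',
      ?_, fun k hk => ?_⟩
    · by_cases hj : j = p + 2
      · subst hj
        simp only [Function.update_self]
        exact ⟨hX, hf⟩
      · simp only [Function.update_of_ne hj]
        exact hZ j h1 (by omega)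
    · convert hv'' using 3 with t x
      rw [List.range'_concat, List.foldr_append]
      have h2p : 2 + 1 * p = p + 2 := by ring
      simp only [List.foldr_cons, List.foldr_nil, h2p, Function.update_self, neg_one_mul]
      refine congrArg (Φ t) (List.foldr_ext _ _ _ fun j hj y => ?_)
      have hj' : j ≠ p + 2 := by
        have := List.mem_range'_1.1 hj
        omega
      rw [Function.update_of_ne hj']
    · rw [hadd k hk]
      rcases Nat.lt_succ_iff_lt_or_eq.1 hk with hk' | rfl
      · rw [hv0 k hk', Pi.single_eq_of_ne (by omega), add_zero]
      · have : ((p + 2 : ℕ) : ℝ) ≠ 0 := by positivity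
        rw [show p + 2 - 1 = p + 1 from rfl, Pi.single_eq_same, hXdef, smul_smul, mul_assoc,
          mul_inv_cancel₀ this, mul_one, neg_one_smul, add_neg_cancel]

end Expansion

/-- **Proposition 3.5 of ter Elst–Robinson, "Uniform subellipticity".**
Let `Y₁, Y₂` be `C_b^∞`-vector fields on `ℝ^d` and `N ≥ 2`.  Then there are `c > 0` and
`C_b^∞`-vector fields `Z₂, …, Z_N`, each `Z_j` a real linear combination of iterated
commutators of `Y₁, Y₂` of length `j`, such that
`|exp(t(Y₁+Y₂)) exp(−tY₁) exp(−tY₂) exp(−t²Z₂) ⋯ exp(−t^N Z_N)(x) − x| ≤ c |t|^{N+1}`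
uniformly for `x ∈ ℝ^d` and `t ∈ [−1,1]`. -/
theorem flow_product_CBH_estimate (d N : ℕ) (hN : 2 ≤ N)
    (Y : Fin 2 → Ec d → Ec d) (hY : ∀ i, IsCbVF (Y i))
    (f12 f1 f2 : ℝ → Ec d → Ec d)
    (hf12 : IsFlowOf (fun x => Y 0 x + Y 1 x) f12)
    (hf1 : IsFlowOf (Y 0) f1) (hf2 : IsFlowOf (Y 1) f2) :
    ∃ c : ℝ, 0 < c ∧
    ∃ Z : ℕ → Ec d → Ec d, ∃ g : ℕ → ℝ → Ec d → Ec d,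
      (∀ j, 2 ≤ j → j ≤ N →
        IsCbVF (Z j) ∧ IsFlowOf (Z j) (g j) ∧
        ∃ coef : (Fin j → Fin 2) → ℝ,
          Z j = fun x => ∑ v : Fin j → Fin 2, coef v • multiComm Y (List.ofFn v) x) ∧
      ∀ t : ℝ, |t| ≤ 1 → ∀ x : Ec d,
        ‖f12 t (f1 (-t) (f2 (-t)
            ((List.range' 2 (N - 1)).foldr (fun j y => g j (-(t ^ j)) y) x))) - x‖ ≤
          c * |t| ^ (N + 1) := by
  have hY' : ∀ i, CbSmooth (Y i) := hY
  have h0 := mem_commSpan_one (Y := Y) 0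
  have h1 := mem_commSpan_one (Y := Y) 1
  obtain ⟨u, hu, hu0⟩ := (IsGeneratedBy.id (Y := Y) (N := N)).comp_flow hY' (add_mem h0 h1)
    le_rfl (by omega) hf12 (c := 1) (by simp)
  obtain ⟨v, hv, hv0⟩ := hu.comp_flow hY' h0 le_rfl (by omega) hf1 (c := -1) (by simp)
  obtain ⟨w, hw, hw0⟩ := hv.comp_flow hY' h1 le_rfl (by omega) hf2 (c := -1) (by simp)
  have hw00 : w 0 = 0 := by
    rw [hw0 0 one_pos, hv0 0 one_pos, hu0 0 one_pos]
    simp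
  obtain ⟨Z, g, hZ, z, hz, hz0⟩ := hw.exists_foldr hY' hw00 (N - 1) (by omega)
  obtain ⟨C, hC0, hC⟩ := hz.exists_norm_sub_le fun k hk => hz0 k (by omega)
  refine ⟨C + 1, by positivity, Z, g, fun j h2 hj => ?_, fun t ht x => ?_⟩
  · obtain ⟨hZj, hgj⟩ := hZ j h2 (by omega)
    obtain ⟨coef, hcoef⟩ := (Submodule.mem_span_range_iff_exists_fun ℝ).1 hZj
    refine ⟨cbSmooth_of_mem_commSpan hY' hZj, hgj, coef, ?_⟩
    rw [← hcoef]
    funext x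
    simp
  · have h := hC t ht x
    simp only [pow_one, one_mul, neg_one_mul] at h
    refine h.trans ?_
    gcongr
    linarith

end
end
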